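/- arXiv:2206.09804 — 2 statements merged into one kernel-verified Lean document; each statement's English description precedes it below -/
import Mathlib

section
/- Let S be a cap of size 112 in F = (Fin 6 → ZMod 3). A two-dimensional subspace W of the dual space of F yields the nine-slice multiset {18, 18, 18, 18, 9, 9, 9, 9, 4} (i.e. for a basis (ℓ₁, ℓ₂) of W the multiset of the nine cardinalities |S ∩ ℓ₁⁻¹(a) ∩ ℓ₂⁻¹(b)| is {18, 18, 18, 18, 9, 9, 9, 9, 4}) if and only if W is spanned by two linearly independent functionals each of whose slice multiset is {45, 45, 22}. -/
/-- A cap in the `n`-dimensional affine space over the field of three elements. -/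
def IsCap {n : ℕ} (S : Finset (Fin n → ZMod 3)) : Prop :=
  ∀ a ∈ S, ∀ b ∈ S, ∀ c ∈ S, a ≠ b → a ≠ c → b ≠ c → a + b + c ≠ 0

/-- The slice multiset of a linear functional `ℓ` with respect to `S`. -/
def sliceMul {n : ℕ} (S : Finset (Fin n → ZMod 3))
    (ℓ : (Fin n → ZMod 3) →ₗ[ZMod 3] ZMod 3) : Multiset ℕ :=
  (Finset.univ : Finset (ZMod 3)).val.map fun i => (S.filter fun x => ℓ x = i).card

/-- The multiset of the nine cardinalities `|S ∩ ℓ₁⁻¹(a) ∩ ℓ₂⁻¹(b)|`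
for `(a, b) ∈ (ZMod 3)²`. -/
def nineMul {n : ℕ} (S : Finset (Fin n → ZMod 3))
    (ℓ₁ ℓ₂ : (Fin n → ZMod 3) →ₗ[ZMod 3] ZMod 3) : Multiset ℕ :=
  (Finset.univ : Finset (ZMod 3 × ZMod 3)).val.map
    fun p => (S.filter fun x => ℓ₁ x = p.1 ∧ ℓ₂ x = p.2).card

namespace CapSlices

open Finset Module

section Counting

variable {V : Type} [AddCommGroup V]

/-- A set in which `a + b + c = 0` has only the trivial solutions `a = b = c`. -/
def LineFree (S : Finset V) : Prop :=
  ∀ a ∈ S, ∀ b ∈ S, ∀ c ∈ S, a + b + c = 0 → a = b ∧ b = c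

theorem LineFree.mono {S T : Finset V} (hS : LineFree S) (h : T ⊆ S) : LineFree T :=
  fun a ha b hb c hc => hS a (h ha) b (h hb) c (h hc)

variable [Module (ZMod 3) V]

/-- The part of `S` on the level set `ℓ = i`. -/
def slice (S : Finset V) (ℓ : Dual (ZMod 3) V) (i : ZMod 3) : Finset V :=
  S.filter fun p => ℓ p = i

/-- The size of a slice. -/
def sliceCard (S : Finset V) (ℓ : Dual (ZMod 3) V) (i : ZMod 3) : ℕ :=
  (slice S ℓ i).card

/-- The value of `ω ^ t + ω ^ (2 * t)` for a primitive cube root of unity `ω`. -/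
def kernel (t : ZMod 3) : ℤ := if t = 0 then 2 else -1

/-- Twice the squared modulus of the Fourier coefficient of `A` at `m`. -/
def quadSum (A : Finset V) (m : Dual (ZMod 3) V) : ℤ :=
  ∑ p ∈ A, ∑ q ∈ A, kernel (m (p - q))

/-- Twice the real part of the product of the Fourier coefficients of `A`, `B`, `C` at `m`. -/
def tripleSum (A B C : Finset V) (m : Dual (ZMod 3) V) : ℤ :=
  ∑ p ∈ A, ∑ q ∈ B, ∑ r ∈ C, kernel (m (p + q + r))

theorem slice_subset (S : Finset V) (ℓ : Dual (ZMod 3) V) (i : ZMod 3) : slice S ℓ i ⊆ S :=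
  filter_subset _ _

theorem mem_slice {S : Finset V} {ℓ : Dual (ZMod 3) V} {i : ZMod 3} {p : V} :
    p ∈ slice S ℓ i ↔ p ∈ S ∧ ℓ p = i := mem_filter

theorem sum_zmod_three {M : Type*} [AddCommMonoid M] (f : ZMod 3 → M) :
    ∑ x, f x = f 0 + f 1 + f 2 := Fin.sum_univ_three f

theorem sum_comp_eq (A : Finset V) (m : Dual (ZMod 3) V) (φ : ZMod 3 → ℤ) :
    ∑ p ∈ A, φ (m p) =
      sliceCard A m 0 * φ 0 + sliceCard A m 1 * φ 1 + sliceCard A m 2 * φ 2 := by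
  have h : ∀ x : ZMod 3, ∑ p ∈ A with m p = x, φ (m p) = sliceCard A m x * φ x := by
    intro x
    rw [sum_congr rfl (g := fun _ => φ x) (fun p hp => by rw [(mem_filter.1 hp).2])]
    simp [sliceCard, slice]
  rw [← sum_fiberwise A (fun p => m p), sum_zmod_three]
  simp only [h]

theorem sum_sliceCard (A : Finset V) (m : Dual (ZMod 3) V) :
    sliceCard A m 0 + sliceCard A m 1 + sliceCard A m 2 = A.card := by
  have := sum_comp_eq A m fun _ => 1
  simp only [sum_const, mul_one, nsmul_eq_mul] at this
  exact_mod_cast this.symm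

/-- `quadSum` in terms of slice sizes. -/
def quadForm (x y z : ℤ) : ℤ := 2 * (x * x + y * y + z * z - x * y - y * z - x * z)

/-- `tripleSum` in terms of slice sizes. -/
def triForm (a₀ a₁ a₂ b₀ b₁ b₂ c₀ c₁ c₂ : ℤ) : ℤ :=
  3 * (a₀ * (b₀ * c₀ + b₁ * c₂ + b₂ * c₁) + a₁ * (b₀ * c₂ + b₁ * c₁ + b₂ * c₀)
    + a₂ * (b₀ * c₁ + b₁ * c₀ + b₂ * c₂)) - (a₀ + a₁ + a₂) * (b₀ + b₁ + b₂) * (c₀ + c₁ + c₂)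

/-- `tripleSum` of a set with itself in terms of slice sizes. -/
def cubicForm (x y z : ℤ) : ℤ := (2 * x - y - z) * (2 * y - x - z) * (2 * z - x - y)

theorem kernel_values : kernel 0 = 2 ∧ kernel 1 = -1 ∧ kernel 2 = -1 := by decide

theorem quadSum_eq (A : Finset V) (m : Dual (ZMod 3) V) :
    quadSum A m = quadForm (sliceCard A m 0) (sliceCard A m 1) (sliceCard A m 2) := by
  obtain ⟨h0, h1, h2⟩ := kernel_values
  simp only [quadSum, map_sub]
  simp_rw [fun x : ZMod 3 => sum_comp_eq A m (fun y => kernel (x - y))]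
  rw [sum_comp_eq A m (fun x => _ * kernel (x - 0) + _ * kernel (x - 1) + _ * kernel (x - 2))]
  simp only [show (0 - 0 : ZMod 3) = 0 from rfl, show (0 - 1 : ZMod 3) = 2 from rfl,
    show (0 - 2 : ZMod 3) = 1 from rfl, show (1 - 0 : ZMod 3) = 1 from rfl,
    show (1 - 1 : ZMod 3) = 0 from rfl, show (1 - 2 : ZMod 3) = 2 from rfl,
    show (2 - 0 : ZMod 3) = 2 from rfl, show (2 - 1 : ZMod 3) = 1 from rfl,
    show (2 - 2 : ZMod 3) = 0 from rfl, h0, h1, h2, quadForm]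
  ring

theorem tripleSum_eq (A B C : Finset V) (m : Dual (ZMod 3) V) :
    tripleSum A B C m = triForm (sliceCard A m 0) (sliceCard A m 1) (sliceCard A m 2)
      (sliceCard B m 0) (sliceCard B m 1) (sliceCard B m 2)
      (sliceCard C m 0) (sliceCard C m 1) (sliceCard C m 2) := by
  obtain ⟨h0, h1, h2⟩ := kernel_values
  simp only [tripleSum, map_add]
  simp_rw [fun x y : ZMod 3 => sum_comp_eq C m (fun z => kernel (x + y + z))]
  set c := sliceCard C m
  have hB := fun x : ZMod 3 => sum_comp_eq B m (fun y => c 0 * kernel (x + y + 0)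
    + c 1 * kernel (x + y + 1) + c 2 * kernel (x + y + 2))
  simp only [hB]
  set b := sliceCard B m
  rw [sum_comp_eq A m (fun x =>
    b 0 * (c 0 * kernel (x + 0 + 0) + c 1 * kernel (x + 0 + 1) + c 2 * kernel (x + 0 + 2))
    + b 1 * (c 0 * kernel (x + 1 + 0) + c 1 * kernel (x + 1 + 1) + c 2 * kernel (x + 1 + 2))
    + b 2 * (c 0 * kernel (x + 2 + 0) + c 1 * kernel (x + 2 + 1) + c 2 * kernel (x + 2 + 2)))]
  simp only [add_zero, zero_add, show (1 + 1 : ZMod 3) = 2 from rfl,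
    show (1 + 2 : ZMod 3) = 0 from rfl, show (2 + 1 : ZMod 3) = 0 from rfl,
    show (2 + 2 : ZMod 3) = 1 from rfl, h0, h1, h2, triForm]
  ring

theorem tripleSum_self_eq (A : Finset V) (m : Dual (ZMod 3) V) :
    tripleSum A A A m = cubicForm (sliceCard A m 0) (sliceCard A m 1) (sliceCard A m 2) := by
  rw [tripleSum_eq, triForm, cubicForm]
  ring

theorem card_dual [Fintype (Dual (ZMod 3) V)] :
    Fintype.card (Dual (ZMod 3) V) = 3 ^ finrank (ZMod 3) V := by
  rw [Module.card_eq_pow_finrank (K := ZMod 3), ZMod.card, Subspace.dual_finrank_eq]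

theorem sum_kernel [DecidableEq V] [Fintype (Dual (ZMod 3) V)] (v : V) :
    ∑ m : Dual (ZMod 3) V, kernel (m v) =
      if v = 0 then 2 * 3 ^ finrank (ZMod 3) V else 0 := by
  split_ifs with hv
  · subst hv
    simp [kernel, card_dual, mul_comm]
  · obtain ⟨f, hf⟩ : ∃ f : Dual (ZMod 3) V, f v = 1 := by
      obtain ⟨f, hf⟩ : ∃ f : Dual (ZMod 3) V, f v ≠ 0 := by
        by_contra! h
        exact hv ((Module.forall_dual_apply_eq_zero_iff (ZMod 3) v).1 h)
      exact ⟨(f v)⁻¹ • f, by simp [hf]⟩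
    have h1 := Equiv.sum_comp (Equiv.addRight f) fun m : Dual (ZMod 3) V => kernel (m v)
    have h2 := Equiv.sum_comp (Equiv.addRight (f + f)) fun m : Dual (ZMod 3) V => kernel (m v)
    simp only [Equiv.coe_addRight, LinearMap.add_apply, hf] at h1 h2
    have h3 : ∀ t : ZMod 3, kernel t + kernel (t + 1) + kernel (t + (1 + 1)) = 0 := by decide
    have h4 := sum_congr rfl fun (m : Dual (ZMod 3) V) (_ : m ∈ univ) => h3 (m v)
    simp only [sum_add_distrib, sum_const_zero] at h4
    linarith

theorem sum_quadSum [Fintype (Dual (ZMod 3) V)] (A : Finset V) :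
    ∑ m, quadSum A m = 2 * 3 ^ finrank (ZMod 3) V * A.card := by
  classical
  simp only [quadSum]
  rw [sum_comm]
  simp_rw [sum_comm (s := (univ : Finset (Dual (ZMod 3) V))), sum_kernel, sub_eq_zero, sum_ite_eq]
  rw [sum_congr rfl fun p hp => if_pos hp]
  simp [mul_comm]

theorem sum_tripleSum_self [Fintype (Dual (ZMod 3) V)] {A : Finset V} (hA : LineFree A) :
    ∑ m, tripleSum A A A m = 2 * 3 ^ finrank (ZMod 3) V * A.card := by
  classical
  simp only [tripleSum]
  rw [sum_comm]
  simp_rw [sum_comm (s := (univ : Finset (Dual (ZMod 3) V))), sum_kernel]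
  have h : ∀ p ∈ A, ∑ q ∈ A, ∑ r ∈ A,
      (if p + q + r = 0 then 2 * 3 ^ finrank (ZMod 3) V else 0 : ℤ) =
        2 * 3 ^ finrank (ZMod 3) V := by
    intro p hp
    rw [sum_eq_single_of_mem p hp, sum_eq_single_of_mem p hp, if_pos]
    · have h3 : (3 : ZMod 3) • p = 0 := by rw [show (3 : ZMod 3) = 0 from rfl, zero_smul]
      rw [← h3]
      module
    · exact fun r hr hne => if_neg fun h => hne (hA p hp p hp r hr h).2.symm
    · exact fun q hq hne => sum_eq_zero fun r hr =>
        if_neg fun h => hne (hA p hp q hq r hr h).1.symm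
  rw [sum_congr rfl h]
  simp [mul_comm]

theorem sum_tripleSum_eq_zero [Fintype (Dual (ZMod 3) V)] {A B C : Finset V}
    (h : ∀ a ∈ A, ∀ b ∈ B, ∀ c ∈ C, a + b + c ≠ 0) :
    ∑ m, tripleSum A B C m = 0 := by
  classical
  simp only [tripleSum]
  rw [sum_comm]
  simp_rw [sum_comm (s := (univ : Finset (Dual (ZMod 3) V))), sum_kernel]
  exact sum_eq_zero fun p hp => sum_eq_zero fun q hq => sum_eq_zero fun r hr =>
    if_neg (h p hp q hq r hr)

end Counting

section Grids

/-- The three slice sizes of `A` along `m`. -/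
def profile {V : Type} [AddCommGroup V] [Module (ZMod 3) V] (A : Finset V)
    (m : Dual (ZMod 3) V) : ℕ × ℕ × ℕ :=
  (sliceCard A m 0, sliceCard A m 1, sliceCard A m 2)

/-- `quadSum` as a function of the profile. -/
def quad (a : ℕ × ℕ × ℕ) : ℤ := quadForm a.1 a.2.1 a.2.2

/-- `tripleSum` of a set with itself as a function of the profile. -/
def cubic (a : ℕ × ℕ × ℕ) : ℤ := cubicForm a.1 a.2.1 a.2.2

/-- `tripleSum` as a function of the profiles. -/
def triple (a b c : ℕ × ℕ × ℕ) : ℤ :=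
  triForm a.1 a.2.1 a.2.2 b.1 b.2.1 b.2.2 c.1 c.2.1 c.2.2

/-- Integer coefficients of a combination of the forms attached to three rows. -/
structure Weights where
  /-- coefficient of `quad` of the first row -/
  qa : ℤ
  /-- coefficient of `cubic` of the first row -/
  ca : ℤ
  /-- coefficient of `quad` of the second row -/
  qb : ℤ
  /-- coefficient of `cubic` of the second row -/
  cb : ℤ
  /-- coefficient of `quad` of the third row -/
  qc : ℤ
  /-- coefficient of `cubic` of the third row -/
  cc : ℤ
  /-- coefficient of `triple` -/
  tr : ℤ
  /-- constant term -/
  co : ℤ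

/-- The weighted combination of forms of three rows. -/
def Weights.value (w : Weights) (a b c : ℕ × ℕ × ℕ) : ℤ :=
  w.qa * quad a + w.ca * cubic a + w.qb * quad b + w.cb * cubic b
    + w.qc * quad c + w.cc * cubic c + w.tr * triple a b c + w.co

/-- The sum of `Weights.value` over all functionals outside the line spanned by a functional with
slices of sizes `x`, `y`, `z`, in a space with `D` points. -/
def Weights.total (w : Weights) (D x y z : ℤ) : ℤ :=
  w.qa * (2 * D * x - 6 * x ^ 2) + w.ca * (2 * D * x - 6 * x ^ 3)
    + w.qb * (2 * D * y - 6 * y ^ 2) + w.cb * (2 * D * y - 6 * y ^ 3)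
    + w.qc * (2 * D * z - 6 * z ^ 2) + w.cc * (2 * D * z - 6 * z ^ 3)
    + w.tr * (-6 * x * y * z) + w.co * (D - 3)

/-- The transversal lines of the grid with rows `a`, `b`, `c` all satisfy `v`. -/
def linesValid (v : ℕ × ℕ × ℕ → Bool) (a b c : ℕ × ℕ × ℕ) : Bool :=
  v (a.1, b.1, c.1) && v (a.1, b.2.1, c.2.2) && v (a.1, b.2.2, c.2.1) &&
  v (a.2.1, b.1, c.2.2) && v (a.2.1, b.2.1, c.2.1) && v (a.2.1, b.2.2, c.1) &&
  v (a.2.2, b.1, c.2.1) && v (a.2.2, b.2.1, c.1) && v (a.2.2, b.2.2, c.2.2)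

/-- Sums along the first transversal parallel class. -/
def classA (a b c : ℕ × ℕ × ℕ) : ℕ × ℕ × ℕ :=
  (a.1 + b.1 + c.1, a.2.1 + b.2.1 + c.2.1, a.2.2 + b.2.2 + c.2.2)

/-- Sums along the second transversal parallel class. -/
def classB (a b c : ℕ × ℕ × ℕ) : ℕ × ℕ × ℕ :=
  (a.1 + b.2.1 + c.2.2, a.2.1 + b.2.2 + c.1, a.2.2 + b.1 + c.2.1)

/-- Sums along the third transversal parallel class. -/
def classC (a b c : ℕ × ℕ × ℕ) : ℕ × ℕ × ℕ :=
  (a.1 + b.2.2 + c.2.1, a.2.1 + b.1 + c.2.2, a.2.2 + b.2.1 + c.1)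

/-- The triples of sum `n` satisfying `v`. -/
def triples (v : ℕ × ℕ × ℕ → Bool) (n : ℕ) : List (ℕ × ℕ × ℕ) :=
  ((List.range (n + 1)).flatMap fun x =>
    (List.range (n + 1 - x)).map fun y => (x, y, n - x - y)).filter v

/-- Cyclic rotation of a triple. -/
def rot (a : ℕ × ℕ × ℕ) : ℕ × ℕ × ℕ := (a.2.1, a.2.2, a.1)

/-- The first entry is maximal. -/
def headMax (a : ℕ × ℕ × ℕ) : Bool := a.2.1.ble a.1 && a.2.2.ble a.1

/-- All grids with valid rows of given sums, the first two starting with a maximal entry, and with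
valid transversal lines satisfy `Φ`. -/
def gridAll (v : ℕ × ℕ × ℕ → Bool) (x y z : ℕ)
    (Φ : ℕ × ℕ × ℕ → ℕ × ℕ × ℕ → ℕ × ℕ × ℕ → Bool) : Bool :=
  ((triples v x).filter headMax).all fun a => ((triples v y).filter headMax).all fun b =>
    (triples v z).all fun c => !linesValid v a b c || Φ a b c

/-- Invariance of a grid property under the translations of the grid fixing every row. -/
def RotInvariant (Φ : ℕ × ℕ × ℕ → ℕ × ℕ × ℕ → ℕ × ℕ × ℕ → Bool) : Prop :=
  ∀ a b c, Φ (rot a) b (rot (rot c)) = Φ a b c ∧ Φ a (rot b) (rot (rot c)) = Φ a b c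

theorem mem_triples {v : ℕ × ℕ × ℕ → Bool} {n : ℕ} {a : ℕ × ℕ × ℕ} (hv : v a = true)
    (hn : a.1 + a.2.1 + a.2.2 = n) : a ∈ triples v n := by
  obtain ⟨x, y, z⟩ := a
  simp only at hn
  simp only [triples, List.mem_filter, List.mem_flatMap, List.mem_map, List.mem_range]
  exact ⟨⟨x, by omega, y, by omega, by rw [show n - x - y = z by omega]⟩, hv⟩

theorem rotInvariant_linesValid (v : ℕ × ℕ × ℕ → Bool) : RotInvariant (linesValid v) := by
  intro a b c
  simp only [linesValid, rot]
  constructor <;> ac_rfl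

theorem exists_headMax_rot (a : ℕ × ℕ × ℕ) :
    headMax a = true ∨ headMax (rot a) = true ∨ headMax (rot (rot a)) = true := by
  simp only [headMax, rot, Bool.and_eq_true, Nat.ble_eq]
  omega

theorem headMax_induction {P : ℕ × ℕ × ℕ → Prop} (h : ∀ a, headMax a = true → P a)
    (hrot : ∀ a, P (rot a) → P a) (a : ℕ × ℕ × ℕ) : P a := by
  rcases exists_headMax_rot a with h' | h' | h'
  · exact h _ h'
  · exact hrot _ (h _ h')
  · exact hrot _ (hrot _ (h _ h'))

theorem sum_rot {a : ℕ × ℕ × ℕ} {n : ℕ} (h : a.1 + a.2.1 + a.2.2 = n) :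
    (rot a).1 + (rot a).2.1 + (rot a).2.2 = n := by
  simp only [rot]
  omega

theorem gridAll_apply {v : ℕ × ℕ × ℕ → Bool} (hv : ∀ a, v (rot a) = v a) {x y z : ℕ}
    {Φ : ℕ × ℕ × ℕ → ℕ × ℕ × ℕ → ℕ × ℕ × ℕ → Bool} (hΦ : RotInvariant Φ)
    (h : gridAll v x y z Φ = true) (a b c : ℕ × ℕ × ℕ) :
    v a = true → v b = true → v c = true → a.1 + a.2.1 + a.2.2 = x → b.1 + b.2.1 + b.2.2 = y →
    c.1 + c.2.1 + c.2.2 = z → linesValid v a b c = true → Φ a b c = true := by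
  induction a using headMax_induction generalizing b c with
  | h a ha =>
    induction b using headMax_induction generalizing c with
    | h b hb =>
      intro va vb vc hx hy hz hl
      have h' := List.all_eq_true.1 (List.all_eq_true.1 (List.all_eq_true.1 h a
        (List.mem_filter.2 ⟨mem_triples va hx, ha⟩)) b (List.mem_filter.2 ⟨mem_triples vb hy, hb⟩))
        c (mem_triples vc hz)
      simpa [hl] using h'
    | hrot b IH =>
      intro va vb vc hx hy hz hl
      rw [← (hΦ a b c).2]
      exact IH _ va (by rw [hv, vb]) (by rw [hv, hv, vc]) hx (sum_rot hy) (sum_rot (sum_rot hz))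
        (by rw [(rotInvariant_linesValid v a b c).2, hl])
  | hrot a IH =>
    intro va vb vc hx hy hz hl
    rw [← (hΦ a b c).1]
    exact IH _ _ (by rw [hv, va]) vb (by rw [hv, hv, vc]) (sum_rot hx) hy (sum_rot (sum_rot hz))
      (by rw [(rotInvariant_linesValid v a b c).1, hl])

/-- Nonnegativity of a weighted value, corrected by a function of the products of the class sums,
for grids whose classes satisfy `cls`. -/
def certificate (w : Weights) (lam : ℕ → ℤ) (cls : ℕ × ℕ × ℕ → Bool) (a b c : ℕ × ℕ × ℕ) : Bool :=
  let p := classA a b c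
  let q := classB a b c
  let r := classC a b c
  !(cls p && cls q && cls r) || decide (0 ≤ w.value a b c + lam (p.1 * p.2.1 * p.2.2)
    + lam (q.1 * q.2.1 * q.2.2) + lam (r.1 * r.2.1 * r.2.2))

theorem Weights.value_rot (w : Weights) (a b c : ℕ × ℕ × ℕ) :
    w.value (rot a) b (rot (rot c)) = w.value a b c ∧
      w.value a (rot b) (rot (rot c)) = w.value a b c := by
  simp only [Weights.value, rot, quad, cubic, triple, quadForm, cubicForm, triForm]
  constructor <;> ring

theorem class_rot_left (a b c : ℕ × ℕ × ℕ) :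
    classA (rot a) b (rot (rot c)) = rot (classC a b c) ∧
      classB (rot a) b (rot (rot c)) = rot (classA a b c) ∧
        classC (rot a) b (rot (rot c)) = rot (classB a b c) := by
  simp only [classA, classB, classC, rot, and_self]

theorem class_rot_right (a b c : ℕ × ℕ × ℕ) :
    classA a (rot b) (rot (rot c)) = classB a b c ∧
      classB a (rot b) (rot (rot c)) = classC a b c ∧
        classC a (rot b) (rot (rot c)) = classA a b c := by
  simp only [classA, classB, classC, rot, and_self]

theorem rotInvariant_certificate (w : Weights) (lam : ℕ → ℤ) {cls : ℕ × ℕ × ℕ → Bool}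
    (hcls : ∀ a, cls (rot a) = cls a) : RotInvariant (certificate w lam cls) := by
  have hprod : ∀ a : ℕ × ℕ × ℕ, (rot a).1 * (rot a).2.1 * (rot a).2.2 = a.1 * a.2.1 * a.2.2 := by
    intro a
    simp only [rot]
    ring
  intro a b c
  simp only [certificate]
  rw [(w.value_rot a b c).1, (w.value_rot a b c).2, (class_rot_left a b c).1,
    (class_rot_left a b c).2.1, (class_rot_left a b c).2.2, (class_rot_right a b c).1,
    (class_rot_right a b c).2.1, (class_rot_right a b c).2.2]
  simp only [hcls, hprod]
  constructor
  · congr 2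
    · cases cls (classA a b c) <;> cases cls (classB a b c) <;> cases cls (classC a b c) <;> rfl
    · congr 1
      ring
  · congr 2
    · cases cls (classA a b c) <;> cases cls (classB a b c) <;> cases cls (classC a b c) <;> rfl
    · congr 1
      ring

end Grids

section Views

theorem univ_zmod_three {i j k : ZMod 3} (hij : i ≠ j) (hik : i ≠ k) (hjk : j ≠ k) :
    (univ : Finset (ZMod 3)) = {i, j, k} := by
  revert i j k
  decide

theorem sum_zmod_distinct {M : Type*} [AddCommMonoid M] (f : ZMod 3 → M) {i j k : ZMod 3}
    (hij : i ≠ j) (hik : i ≠ k) (hjk : j ≠ k) : ∑ x, f x = f i + f j + f k := by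
  rw [univ_zmod_three hij hik hjk, sum_insert (by simp [hij, hik]), sum_pair hjk, add_assoc]

theorem prod_zmod_distinct {M : Type*} [CommMonoid M] (f : ZMod 3 → M) {i j k : ZMod 3}
    (hij : i ≠ j) (hik : i ≠ k) (hjk : j ≠ k) : ∏ x, f x = f i * f j * f k := by
  rw [univ_zmod_three hij hik hjk, prod_insert (by simp [hij, hik]), prod_pair hjk, mul_assoc]

variable {V : Type} [AddCommGroup V] [Module (ZMod 3) V]

theorem sum_sliceCard_distinct (S : Finset V) (ℓ : Dual (ZMod 3) V) {i j k : ZMod 3}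
    (hij : i ≠ j) (hik : i ≠ k) (hjk : j ≠ k) :
    sliceCard S ℓ i + sliceCard S ℓ j + sliceCard S ℓ k = S.card := by
  rw [← sum_zmod_distinct _ hij hik hjk, sum_zmod_three, sum_sliceCard]

theorem sliceCard_add_smul (S : Finset V) (ℓ m : Dual (ZMod 3) V) (s w : ZMod 3) {i j k : ZMod 3}
    (hij : i ≠ j) (hik : i ≠ k) (hjk : j ≠ k) :
    sliceCard S (m + s • ℓ) w = sliceCard (slice S ℓ i) m (w - s * i)
      + sliceCard (slice S ℓ j) m (w - s * j) + sliceCard (slice S ℓ k) m (w - s * k) := by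
  rw [← sum_zmod_distinct (fun x => sliceCard (slice S ℓ x) m (w - s * x)) hij hik hjk, sliceCard,
    card_eq_sum_card_fiberwise (f := fun p => ℓ p) (t := univ) (by simp)]
  refine sum_congr rfl fun x _ => congrArg card ?_
  ext p
  simp only [mem_filter, mem_slice, LinearMap.add_apply, LinearMap.smul_apply, smul_eq_mul]
  constructor
  · rintro ⟨⟨hp, h⟩, rfl⟩
    exact ⟨⟨hp, rfl⟩, eq_sub_of_add_eq h⟩
  · rintro ⟨⟨hp, rfl⟩, h⟩
    exact ⟨⟨hp, by rw [h, sub_add_cancel]⟩, rfl⟩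

theorem slice_add_smul (S : Finset V) (ℓ m : Dual (ZMod 3) V) (s w i : ZMod 3) :
    sliceCard (slice S (m + s • ℓ) w) ℓ i = sliceCard (slice S ℓ i) m (w - s * i) := by
  refine congrArg card ?_
  ext p
  simp only [mem_slice, LinearMap.add_apply, LinearMap.smul_apply, smul_eq_mul]
  constructor
  · rintro ⟨⟨hp, h⟩, rfl⟩
    exact ⟨⟨hp, rfl⟩, eq_sub_of_add_eq h⟩
  · rintro ⟨⟨hp, rfl⟩, h⟩
    exact ⟨⟨hp, by rw [h, sub_add_cancel]⟩, rfl⟩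

theorem tripleSum_smul {ℓ : Dual (ZMod 3) V} {A B C : Finset V} {i j k : ZMod 3}
    (hA : ∀ p ∈ A, ℓ p = i) (hB : ∀ p ∈ B, ℓ p = j) (hC : ∀ p ∈ C, ℓ p = k)
    (h : i + j + k = 0) (s : ZMod 3) :
    tripleSum A B C (s • ℓ) = 2 * A.card * B.card * C.card := by
  have : ∀ p ∈ A, ∀ q ∈ B, ∀ r ∈ C, kernel ((s • ℓ) (p + q + r)) = 2 := by
    intro p hp q hq r hr
    simp [hA p hp, hB q hq, hC r hr, h, kernel]
  rw [tripleSum, sum_congr rfl fun p hp => sum_congr rfl fun q hq => sum_congr rfl (this p hp q hq)]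
  simp
  ring

variable [Fintype (Dual (ZMod 3) V)]

open Classical in
/-- The functionals that are not multiples of `ℓ`. -/
noncomputable def off (ℓ : Dual (ZMod 3) V) : Finset (Dual (ZMod 3) V) :=
  univ.filter fun m => ∀ k : ZMod 3, m ≠ k • ℓ

theorem mem_off {ℓ m : Dual (ZMod 3) V} : m ∈ off ℓ ↔ ∀ k : ZMod 3, m ≠ k • ℓ := by
  simp [off]

theorem ne_zero_of_mem_off {ℓ m : Dual (ZMod 3) V} (hm : m ∈ off ℓ) : m ≠ 0 := by
  simpa using mem_off.1 hm 0

theorem add_smul_mem_off {ℓ m : Dual (ZMod 3) V} (hm : m ∈ off ℓ) (s : ZMod 3) :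
    m + s • ℓ ∈ off ℓ := by
  rw [mem_off] at hm ⊢
  intro k h
  exact hm (k - s) (by rw [eq_sub_of_add_eq h]; module)

theorem sum_off_add {ℓ : Dual (ZMod 3) V} (hℓ : ℓ ≠ 0) (f : Dual (ZMod 3) V → ℤ) :
    ∑ m ∈ off ℓ, f m + ∑ k : ZMod 3, f (k • ℓ) = ∑ m, f m := by
  classical
  rw [← sum_filter_add_sum_filter_not univ (fun m => ∀ k : ZMod 3, m ≠ k • ℓ) f]
  congr 1
  rw [← sum_image (f := f) (fun a _ b _ h => smul_left_injective (ZMod 3) hℓ h)]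
  refine sum_congr ?_ fun _ _ => rfl
  ext m
  simp [eq_comm]

theorem sum_off_translate (ℓ : Dual (ZMod 3) V) (s : ZMod 3) (f : Dual (ZMod 3) V → ℤ) :
    ∑ m ∈ off ℓ, f (m + s • ℓ) = ∑ m ∈ off ℓ, f m := by
  refine sum_nbij' (· + s • ℓ) (· - s • ℓ) (fun m hm => add_smul_mem_off hm s)
    (fun m hm => ?_) (fun m _ => add_sub_cancel_right _ _) (fun m _ => sub_add_cancel _ _)
    (fun _ _ => rfl)
  have := add_smul_mem_off hm (-s)
  rwa [show m + -s • ℓ = m - s • ℓ by module] at this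

theorem card_off {ℓ : Dual (ZMod 3) V} (hℓ : ℓ ≠ 0) :
    ((off ℓ).card : ℤ) = 3 ^ finrank (ZMod 3) V - 3 := by
  have := sum_off_add hℓ fun _ => 1
  simp [card_dual] at this
  linarith

theorem sum_quad_off {ℓ : Dual (ZMod 3) V} (hℓ : ℓ ≠ 0) {A : Finset V} {i : ZMod 3}
    (hA : ∀ p ∈ A, ℓ p = i) : ∑ m ∈ off ℓ, quad (profile A m) =
      2 * 3 ^ finrank (ZMod 3) V * A.card - 6 * (A.card : ℤ) ^ 2 := by
  have h : ∀ k : ZMod 3, quadSum A (k • ℓ) = 2 * (A.card : ℤ) ^ 2 := by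
    intro k
    have : ∀ p ∈ A, ∀ q ∈ A, kernel ((k • ℓ) (p - q)) = 2 := by
      intro p hp q hq
      simp [hA p hp, hA q hq, kernel]
    rw [quadSum, sum_congr rfl fun p hp => sum_congr rfl (this p hp)]
    simp
    ring
  have h' := sum_off_add hℓ (quadSum A)
  rw [sum_quadSum] at h'
  simp only [h, sum_const, card_univ, ZMod.card] at h'
  simp only [quad, profile, ← quadSum_eq]
  simp at h'
  linarith

theorem sum_cubic_off {ℓ : Dual (ZMod 3) V} (hℓ : ℓ ≠ 0) {A : Finset V} (hfree : LineFree A)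
    {i : ZMod 3} (hA : ∀ p ∈ A, ℓ p = i) : ∑ m ∈ off ℓ, cubic (profile A m) =
      2 * 3 ^ finrank (ZMod 3) V * A.card - 6 * (A.card : ℤ) ^ 3 := by
  have h3 : i + i + i = 0 := (by decide : ∀ i : ZMod 3, i + i + i = 0) i
  have h' := sum_off_add hℓ (tripleSum A A A)
  rw [sum_tripleSum_self hfree] at h'
  simp only [tripleSum_smul hA hA hA h3, sum_const, card_univ, ZMod.card] at h'
  simp only [cubic, profile, ← tripleSum_self_eq]
  simp at h'
  linarith

theorem sum_triple_off {ℓ : Dual (ZMod 3) V} (hℓ : ℓ ≠ 0) {S : Finset V} (hS : LineFree S)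
    {i j k : ZMod 3} (hij : i ≠ j) (hik : i ≠ k) (hjk : j ≠ k) :
    ∑ m ∈ off ℓ, triple (profile (slice S ℓ i) m) (profile (slice S ℓ j) m)
      (profile (slice S ℓ k) m) =
        -6 * sliceCard S ℓ i * sliceCard S ℓ j * sliceCard S ℓ k := by
  have h3 : i + j + k = 0 := by revert i j k; decide
  have h' := sum_off_add hℓ (tripleSum (slice S ℓ i) (slice S ℓ j) (slice S ℓ k))
  rw [sum_tripleSum_eq_zero] at h'
  · simp only [tripleSum_smul (fun p hp => (mem_slice.1 hp).2) (fun p hp => (mem_slice.1 hp).2)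
      (fun p hp => (mem_slice.1 hp).2) h3, sum_const, card_univ, ZMod.card] at h'
    simp only [triple, profile, ← tripleSum_eq]
    simp only [sliceCard]
    simp at h'
    linarith
  · intro a ha b hb c hc habc
    rw [mem_slice] at ha hb hc
    have := (hS a ha.1 b hb.1 c hc.1 habc).1
    exact hij (by rw [← ha.2, this, hb.2])

theorem sum_value_off (w : Weights) {ℓ : Dual (ZMod 3) V} (hℓ : ℓ ≠ 0) {S : Finset V}
    (hS : LineFree S) {i j k : ZMod 3} (hij : i ≠ j) (hik : i ≠ k) (hjk : j ≠ k) :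
    ∑ m ∈ off ℓ, w.value (profile (slice S ℓ i) m) (profile (slice S ℓ j) m)
      (profile (slice S ℓ k) m) = w.total (3 ^ finrank (ZMod 3) V)
        (sliceCard S ℓ i) (sliceCard S ℓ j) (sliceCard S ℓ k) := by
  have hq := fun x => sum_quad_off hℓ (A := slice S ℓ x) fun p hp => (mem_slice.1 hp).2
  have hc := fun x => sum_cubic_off hℓ (hS.mono (slice_subset S ℓ x))
    fun p hp => (mem_slice.1 hp).2
  simp only [Weights.value, sum_add_distrib, ← mul_sum, hq, hc, sum_triple_off hℓ hS hij hik hjk,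
    sum_const, nsmul_eq_mul, card_off hℓ, Weights.total]
  simp only [sliceCard]
  ring

end Views

section Inheritance

/-- `v` holds for the three slice sizes of every line-free set along every parallel class of
hyperplanes in dimension `d`. -/
def Bound (d : ℕ) (v : ℕ × ℕ × ℕ → Bool) : Prop :=
  ∀ (V : Type) [AddCommGroup V] [Module (ZMod 3) V] [Finite V], finrank (ZMod 3) V = d →
    ∀ S : Finset V, LineFree S → ∀ ℓ : Dual (ZMod 3) V, ℓ ≠ 0 → ∀ i j k : ZMod 3,
      i ≠ j → i ≠ k → j ≠ k → v (sliceCard S ℓ i, sliceCard S ℓ j, sliceCard S ℓ k) = true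

/-- Line-free sets in dimension `d` have at most `n` points. -/
def CardBound (d n : ℕ) : Prop :=
  ∀ (V : Type) [AddCommGroup V] [Module (ZMod 3) V] [Finite V], finrank (ZMod 3) V = d →
    ∀ S : Finset V, LineFree S → S.card ≤ n

variable {V : Type} [AddCommGroup V] [Module (ZMod 3) V]

/-- A slice, translated into the kernel of the functional. -/
theorem exists_ker_copy {S : Finset V} (hS : LineFree S) {m : Dual (ZMod 3) V} (hm : m ≠ 0)
    (x : ZMod 3) : ∃ T : Finset (LinearMap.ker m), LineFree T ∧ T.card = sliceCard S m x ∧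
      ∃ p : V, ∀ (ℓ : Dual (ZMod 3) V) (i : ZMod 3),
        sliceCard T (ℓ.domRestrict (LinearMap.ker m)) i =
          sliceCard (slice S m x) ℓ (i + ℓ p) := by
  classical
  obtain ⟨q, hq⟩ : ∃ q, m q ≠ 0 := by
    by_contra! h
    exact hm (LinearMap.ext h)
  obtain ⟨p, hp⟩ : ∃ p, m p = x := ⟨(x / m q) • q, by simp [hq]⟩
  let f : LinearMap.ker m ↪ V := ⟨fun u => u + p, fun u v h => Subtype.ext (add_right_cancel h)⟩
  have hf : ∀ u, f u = u + p := fun _ => rfl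
  let T := (slice S m x).preimage f f.injective.injOn
  have hT : ∀ u, u ∈ T ↔ (u : V) + p ∈ slice S m x := fun u => mem_preimage
  have hmap : ∀ r ∈ slice S m x, ∃ u, f u = r := fun r hr =>
    ⟨⟨r - p, by simp [hp, (mem_slice.1 hr).2]⟩, by simp [hf]⟩
  refine ⟨T, ?_, ?_, p, fun ℓ i => ?_⟩
  · intro a ha b hb c hc habc
    have h3 : (3 : ZMod 3) • p = 0 := by rw [show (3 : ZMod 3) = 0 from rfl, zero_smul]
    have h0 : (a : V) + b + c = 0 := by exact_mod_cast congrArg Subtype.val habc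
    obtain ⟨h1, h2⟩ := hS _ (mem_slice.1 ((hT a).1 ha)).1 _ (mem_slice.1 ((hT b).1 hb)).1 _
      (mem_slice.1 ((hT c).1 hc)).1 (by
        rw [← h3, ← zero_add ((3 : ZMod 3) • p), ← h0]
        module)
    exact ⟨Subtype.ext (add_right_cancel h1), Subtype.ext (add_right_cancel h2)⟩
  · rw [sliceCard, ← card_map f]
    congr 1
    ext r
    simp only [mem_map, hT, hf]
    constructor
    · rintro ⟨u, hu, rfl⟩
      exact hu
    · intro hr
      obtain ⟨u, rfl⟩ := hmap r hr
      exact ⟨u, hr, rfl⟩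
  · rw [sliceCard, sliceCard, ← card_map f]
    congr 1
    ext r
    simp only [mem_map]
    simp only [mem_slice (V := LinearMap.ker m), hT, hf, mem_slice (ℓ := ℓ),
      LinearMap.domRestrict_apply]
    constructor
    · rintro ⟨u, ⟨hu, rfl⟩, rfl⟩
      exact ⟨hu, by simp⟩
    · rintro ⟨hr, h⟩
      obtain ⟨u, rfl⟩ := hmap r hr
      rw [hf, map_add] at h
      exact ⟨u, ⟨hr, add_right_cancel h⟩, rfl⟩

theorem finrank_ker_eq [Finite V] {d : ℕ} (hV : finrank (ZMod 3) V = d + 1)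
    {m : Dual (ZMod 3) V} (hm : m ≠ 0) : finrank (ZMod 3) (LinearMap.ker m) = d := by
  have := Module.Dual.finrank_ker_add_one_of_ne_zero hm
  omega

theorem CardBound.sliceCard_le [Finite V] {d n : ℕ} (h : CardBound d n)
    (hV : finrank (ZMod 3) V = d + 1) {S : Finset V} (hS : LineFree S) {m : Dual (ZMod 3) V}
    (hm : m ≠ 0) (x : ZMod 3) : sliceCard S m x ≤ n := by
  obtain ⟨T, hT, hcard, -⟩ := exists_ker_copy hS hm x
  exact hcard ▸ h _ (finrank_ker_eq hV hm) T hT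

theorem domRestrict_ker_ne_zero {ℓ m : Dual (ZMod 3) V} (hm : m ≠ 0)
    (h : ∀ k : ZMod 3, ℓ ≠ k • m) : ℓ.domRestrict (LinearMap.ker m) ≠ 0 := by
  intro h0
  obtain ⟨q, hq⟩ : ∃ q, m q ≠ 0 := by
    by_contra! h
    exact hm (LinearMap.ext h)
  refine h (ℓ q / m q) (LinearMap.ext fun u => ?_)
  have := LinearMap.congr_fun h0 ⟨u - (m u / m q) • q, by simp [hq]⟩
  simp only [LinearMap.domRestrict_apply, map_sub, map_smul, smul_eq_mul, LinearMap.zero_apply,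
    sub_eq_zero] at this
  rw [this, LinearMap.smul_apply, smul_eq_mul]
  ring

theorem Bound.apply_slice [Finite V] {d : ℕ} {v : ℕ × ℕ × ℕ → Bool} (hB : Bound d v)
    (hV : finrank (ZMod 3) V = d + 1) {S : Finset V} (hS : LineFree S) {ℓ m : Dual (ZMod 3) V}
    (hm : m ≠ 0) (h : ∀ k : ZMod 3, ℓ ≠ k • m) (x : ZMod 3) {i j k : ZMod 3} (hij : i ≠ j)
    (hik : i ≠ k) (hjk : j ≠ k) :
    v (sliceCard (slice S m x) ℓ i, sliceCard (slice S m x) ℓ j, sliceCard (slice S m x) ℓ k)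
      = true := by
  obtain ⟨T, hT, -, p, hp⟩ := exists_ker_copy hS hm x
  have := hB _ (finrank_ker_eq hV hm) T hT _ (domRestrict_ker_ne_zero hm h) (i - ℓ p) (j - ℓ p)
    (k - ℓ p) (by simpa using hij) (by simpa using hik) (by simpa using hjk)
  simpa only [hp, sub_add_cancel] using this

/-- The direction `s` for which the levels of `m + t * s • ℓ` are the transversals of slope `t`. -/
theorem exists_class_direction {i j k : ZMod 3} (hij : i ≠ j) (hik : i ≠ k) (hjk : j ≠ k) :
    ∃ s : ZMod 3, ∀ t x : ZMod 3, x + t * s * i - t * s * j = x + t ∧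
      x + t * s * i - t * s * k = x + 2 * t := by
  revert i j k
  decide

theorem class_eq (S : Finset V) (ℓ m : Dual (ZMod 3) V) {i j k s t : ZMod 3} (hij : i ≠ j)
    (hik : i ≠ k) (hjk : j ≠ k) (hs : ∀ x : ZMod 3, x + t * s * i - t * s * j = x + t ∧
      x + t * s * i - t * s * k = x + 2 * t) (x : ZMod 3) :
    sliceCard (slice S ℓ i) m x + sliceCard (slice S ℓ j) m (x + t)
      + sliceCard (slice S ℓ k) m (x + 2 * t) =
        sliceCard S (m + (t * s) • ℓ) (x + t * s * i) := by
  rw [sliceCard_add_smul S ℓ m (t * s) (x + t * s * i) hij hik hjk, (hs x).1, (hs x).2,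
    add_sub_cancel_right]

/-- The product of the slice sizes. -/
def sliceProd (S : Finset V) (m : Dual (ZMod 3) V) : ℕ := ∏ x, sliceCard S m x

theorem sliceProd_eq (S : Finset V) (m : Dual (ZMod 3) V) {i j k : ZMod 3} (hij : i ≠ j)
    (hik : i ≠ k) (hjk : j ≠ k) :
    sliceProd S m = sliceCard S m i * sliceCard S m j * sliceCard S m k :=
  prod_zmod_distinct _ hij hik hjk

variable [Fintype (Dual (ZMod 3) V)]

theorem ne_smul_of_mem_off {ℓ m : Dual (ZMod 3) V} (hℓ : ℓ ≠ 0) (hm : m ∈ off ℓ) (k : ZMod 3) :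
    ℓ ≠ k • m := by
  rintro rfl
  have hk : k ≠ 0 := by
    rintro rfl
    exact hℓ (zero_smul _ _)
  refine mem_off.1 hm k⁻¹ ?_
  rw [smul_smul, inv_mul_cancel₀ hk, one_smul]

theorem linesValid_of_mem_off [Finite V] {d : ℕ} {v : ℕ × ℕ × ℕ → Bool} (hB : Bound d v)
    (hV : finrank (ZMod 3) V = d + 1) {S : Finset V} (hS : LineFree S) {ℓ m : Dual (ZMod 3) V}
    (hℓ : ℓ ≠ 0) (hm : m ∈ off ℓ) {i j k : ZMod 3} (hij : i ≠ j) (hik : i ≠ k) (hjk : j ≠ k) :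
    linesValid v (profile (slice S ℓ i) m) (profile (slice S ℓ j) m) (profile (slice S ℓ k) m)
      = true := by
  have key : ∀ x y z : ZMod 3, x + y + z = 0 → v (sliceCard (slice S ℓ i) m x,
      sliceCard (slice S ℓ j) m y, sliceCard (slice S ℓ k) m z) = true := by
    intro x y z hxyz
    obtain ⟨s, w, rfl, rfl, rfl⟩ : ∃ s w : ZMod 3, w - s * i = x ∧ w - s * j = y ∧ w - s * k = z := by
      revert i j k x y z
      decide +kernel
    have hu := add_smul_mem_off hm s
    have := hB.apply_slice hV hS (ne_zero_of_mem_off hu) (ne_smul_of_mem_off hℓ hu) w hij hik hjk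
    simpa only [slice_add_smul] using this
  simp only [linesValid, profile, Bool.and_eq_true]
  refine ⟨⟨⟨⟨⟨⟨⟨⟨key _ _ _ ?_, key _ _ _ ?_⟩, key _ _ _ ?_⟩, key _ _ _ ?_⟩, key _ _ _ ?_⟩,
    key _ _ _ ?_⟩, key _ _ _ ?_⟩, key _ _ _ ?_⟩, key _ _ _ ?_⟩ <;> decide

/-- The averaging argument: a certificate valid on all admissible grids gives a nonnegative
total. -/
theorem total_nonneg [Finite V] {d : ℕ} {v : ℕ × ℕ × ℕ → Bool} (hB : Bound d v)
    (hv : ∀ a, v (rot a) = v a) (hV : finrank (ZMod 3) V = d + 1) {S : Finset V}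
    (hS : LineFree S) {cls : ℕ × ℕ × ℕ → Bool} (hcls : ∀ a, cls (rot a) = cls a)
    (hclsS : ∀ m : Dual (ZMod 3) V, m ≠ 0 → ∀ i j k : ZMod 3, i ≠ j → i ≠ k → j ≠ k →
      cls (sliceCard S m i, sliceCard S m j, sliceCard S m k) = true)
    {ℓ : Dual (ZMod 3) V} (hℓ : ℓ ≠ 0) {i j k : ZMod 3} (hij : i ≠ j) (hik : i ≠ k) (hjk : j ≠ k)
    {x y z : ℕ} (hi : sliceCard S ℓ i = x) (hj : sliceCard S ℓ j = y) (hk : sliceCard S ℓ k = z)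
    (w : Weights) (lam : ℕ → ℤ) (hgrid : gridAll v x y z (certificate w lam cls) = true) :
    0 ≤ w.total (3 ^ (d + 1)) x y z + 3 * ∑ m ∈ off ℓ, lam (sliceProd S m) := by
  obtain ⟨s, hs⟩ := exists_class_direction hij hik hjk
  have hpos : ∀ m ∈ off ℓ, 0 ≤ w.value (profile (slice S ℓ i) m) (profile (slice S ℓ j) m)
      (profile (slice S ℓ k) m) + lam (sliceProd S (m + (0 * s) • ℓ))
        + lam (sliceProd S (m + (1 * s) • ℓ)) + lam (sliceProd S (m + (2 * s) • ℓ)) := by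
    intro m hm
    have hrow : ∀ n : ZMod 3, v (profile (slice S ℓ n) m) = true := fun n =>
      hB.apply_slice hV hS hℓ (mem_off.1 hm) n (by decide) (by decide) (by decide)
    have h := gridAll_apply hv (rotInvariant_certificate w lam hcls) hgrid _ _ _ (hrow i) (hrow j)
      (hrow k) (by rw [← hi]; exact sum_sliceCard _ _) (by rw [← hj]; exact sum_sliceCard _ _)
      (by rw [← hk]; exact sum_sliceCard _ _) (linesValid_of_mem_off hB hV hS hℓ hm hij hik hjk)
    have hclass : ∀ t : ZMod 3, ∃ n₀ n₁ n₂ : ZMod 3, n₀ ≠ n₁ ∧ n₀ ≠ n₂ ∧ n₁ ≠ n₂ ∧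
        ∀ f : ZMod 3 → ℕ, f = (fun x => sliceCard (slice S ℓ i) m x +
          sliceCard (slice S ℓ j) m (x + t) + sliceCard (slice S ℓ k) m (x + 2 * t)) →
        (f 0, f 1, f 2) = (sliceCard S (m + (t * s) • ℓ) n₀, sliceCard S (m + (t * s) • ℓ) n₁,
          sliceCard S (m + (t * s) • ℓ) n₂) := by
      intro t
      refine ⟨0 + t * s * i, 1 + t * s * i, 2 + t * s * i, by simp, by simp; decide,
        by simp; decide, fun f hf => ?_⟩
      subst hf
      simp only [class_eq S ℓ m hij hik hjk (hs t)]
    have hclass' : ∀ t : ZMod 3, ∀ f : ZMod 3 → ℕ, f = (fun x => sliceCard (slice S ℓ i) m x +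
          sliceCard (slice S ℓ j) m (x + t) + sliceCard (slice S ℓ k) m (x + 2 * t)) →
        cls (f 0, f 1, f 2) = true ∧ f 0 * f 1 * f 2 = sliceProd S (m + (t * s) • ℓ) := by
      intro t f hf
      obtain ⟨n₀, n₁, n₂, h01, h02, h12, h⟩ := hclass t
      have h' := h f hf
      rw [h', sliceProd_eq S _ h01 h02 h12]
      simp only [Prod.mk.injEq] at h'
      rw [h'.1, h'.2.1, h'.2.2]
      exact ⟨hclsS _ (ne_zero_of_mem_off (add_smul_mem_off hm _)) _ _ _ h01 h02 h12, rfl⟩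
    obtain ⟨hA, hA'⟩ := hclass' 0 _ rfl
    obtain ⟨hB, hB'⟩ := hclass' 1 _ rfl
    obtain ⟨hC, hC'⟩ := hclass' 2 _ rfl
    rw [← hA', ← hB', ← hC']
    simp only [certificate, Bool.or_eq_true, decide_eq_true_eq] at h
    refine h.resolve_left ?_
    simp only [Bool.not_eq_true', Bool.and_eq_false_iff, not_or, Bool.not_eq_false]
    exact ⟨⟨hA, hB⟩, hC⟩
  have hsum := sum_nonneg hpos
  simp only [sum_add_distrib] at hsum
  rw [sum_value_off w hℓ hS hij hik hjk, sum_off_translate ℓ _ fun m => lam (sliceProd S m),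
    sum_off_translate ℓ _ fun m => lam (sliceProd S m),
    sum_off_translate ℓ _ fun m => lam (sliceProd S m), hi, hj, hk, hV] at hsum
  linarith

end Inheritance

section Global

variable {V : Type} [AddCommGroup V] [Module (ZMod 3) V]

theorem sliceProd_smul (S : Finset V) (ℓ : Dual (ZMod 3) V) {k : ZMod 3} (hk : k ≠ 0) :
    sliceProd S (k • ℓ) = sliceProd S ℓ := by
  refine Fintype.prod_equiv (Equiv.mulLeft₀ k⁻¹ (inv_ne_zero hk)) _ _ fun x => congrArg card ?_
  ext p
  simp only [mem_slice, LinearMap.smul_apply, smul_eq_mul, Equiv.mulLeft₀_apply]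
  rw [eq_inv_mul_iff_mul_eq₀ hk]

theorem sliceProd_eq_profile (S : Finset V) (m : Dual (ZMod 3) V) :
    sliceProd S m = (profile S m).1 * (profile S m).2.1 * (profile S m).2.2 :=
  sliceProd_eq S m (by decide) (by decide) (by decide)

theorem exists_subset_sliceCard (S : Finset V) (ℓ : Dual (ZMod 3) V) {i j k : ZMod 3}
    (hij : i ≠ j) (hik : i ≠ k) (hjk : j ≠ k) {x y z : ℕ} (hx : x ≤ sliceCard S ℓ i)
    (hy : y ≤ sliceCard S ℓ j) (hz : z ≤ sliceCard S ℓ k) : ∃ T ⊆ S, T.card = x + y + z ∧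
      sliceCard T ℓ i = x ∧ sliceCard T ℓ j = y ∧ sliceCard T ℓ k = z := by
  classical
  obtain ⟨A, hA, rfl⟩ := exists_subset_card_eq hx
  obtain ⟨B, hB, rfl⟩ := exists_subset_card_eq hy
  obtain ⟨C, hC, rfl⟩ := exists_subset_card_eq hz
  have hA' := fun p hp => mem_slice.1 (@hA p hp)
  have hB' := fun p hp => mem_slice.1 (@hB p hp)
  have hC' := fun p hp => mem_slice.1 (@hC p hp)
  have hi : slice (A ∪ B ∪ C) ℓ i = A := by
    ext p
    simp only [mem_slice, mem_union]
    grind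
  have hj : slice (A ∪ B ∪ C) ℓ j = B := by
    ext p
    simp only [mem_slice, mem_union]
    grind
  have hk : slice (A ∪ B ∪ C) ℓ k = C := by
    ext p
    simp only [mem_slice, mem_union]
    grind
  refine ⟨A ∪ B ∪ C, fun p hp => ?_, ?_, congrArg card hi, congrArg card hj, congrArg card hk⟩
  · simp only [mem_union] at hp
    rcases hp with (hp | hp) | hp
    exacts [(hA' p hp).1, (hB' p hp).1, (hC' p hp).1]
  · rw [← sum_sliceCard_distinct _ ℓ hij hik hjk, sliceCard, sliceCard, sliceCard, hi, hj, hk]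

/-- All three entries are at most `n`. -/
def entriesLe (n : ℕ) (a : ℕ × ℕ × ℕ) : Bool := a.1.ble n && a.2.1.ble n && a.2.2.ble n

theorem entriesLe_iff {n x y z : ℕ} : entriesLe n (x, y, z) = true ↔ x ≤ n ∧ y ≤ n ∧ z ≤ n := by
  simp [entriesLe, and_assoc]

theorem entriesLe_rot (n : ℕ) (a : ℕ × ℕ × ℕ) : entriesLe n (rot a) = entriesLe n a := by
  simp only [entriesLe, rot]
  ac_rfl

/-- The product of the entries belongs to `L`. -/
def prodIn (L : List ℕ) (a : ℕ × ℕ × ℕ) : Bool := L.any fun p => (a.1 * a.2.1 * a.2.2).beq p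

theorem prodIn_iff {L : List ℕ} {a : ℕ × ℕ × ℕ} :
    prodIn L a = true ↔ a.1 * a.2.1 * a.2.2 ∈ L := by
  simp [prodIn]

theorem prodIn_rot (L : List ℕ) (a : ℕ × ℕ × ℕ) : prodIn L (rot a) = prodIn L a := by
  rw [prodIn, prodIn, show (rot a).1 * (rot a).2.1 * (rot a).2.2 = a.1 * a.2.1 * a.2.2 by
    simp only [rot]; ring]

/-- `a` is a permutation of `(x, y, z)`. -/
def isPerm (x y z : ℕ) (a : ℕ × ℕ × ℕ) : Bool :=
  [(x, y, z), (x, z, y), (y, x, z), (y, z, x), (z, x, y), (z, y, x)].contains a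

theorem exists_of_isPerm {S : Finset V} {m : Dual (ZMod 3) V} {x y z : ℕ}
    (h : isPerm x y z (profile S m) = true) : ∃ i j k : ZMod 3, i ≠ j ∧ i ≠ k ∧ j ≠ k ∧
      sliceCard S m i = x ∧ sliceCard S m j = y ∧ sliceCard S m k = z := by
  simp only [isPerm, profile, List.contains_iff_mem, List.mem_cons, Prod.mk.injEq,
    List.not_mem_nil, or_false] at h
  rcases h with h | h | h | h | h | h
  · exact ⟨0, 1, 2, by decide, by decide, by decide, h.1, h.2.1, h.2.2⟩
  · exact ⟨0, 2, 1, by decide, by decide, by decide, h.1, h.2.2, h.2.1⟩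
  · exact ⟨1, 0, 2, by decide, by decide, by decide, h.2.1, h.1, h.2.2⟩
  · exact ⟨2, 0, 1, by decide, by decide, by decide, h.2.2, h.1, h.2.1⟩
  · exact ⟨1, 2, 0, by decide, by decide, by decide, h.2.1, h.2.2, h.1⟩
  · exact ⟨2, 1, 0, by decide, by decide, by decide, h.2.2, h.2.1, h.1⟩

theorem profile_mem_triples [Finite V] {d n N : ℕ} (h : CardBound d n)
    (hV : finrank (ZMod 3) V = d + 1) {S : Finset V} (hS : LineFree S) (hN : S.card = N)
    {m : Dual (ZMod 3) V} (hm : m ≠ 0) : profile S m ∈ triples (entriesLe n) N :=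
  mem_triples (entriesLe_iff.2 ⟨h.sliceCard_le hV hS hm 0, h.sliceCard_le hV hS hm 1,
    h.sliceCard_le hV hS hm 2⟩) ((sum_sliceCard S m).trans hN)

/-- A combination of `cubic`, `quad` and a constant. -/
def globalForm (α β γ : ℤ) (a : ℕ × ℕ × ℕ) : ℤ := α * cubic a + β * quad a + γ

theorem sum_globalForm [Fintype (Dual (ZMod 3) V)] [DecidableEq (Dual (ZMod 3) V)] {d : ℕ}
    (hV : finrank (ZMod 3) V = d) {S : Finset V} (hS : LineFree S) (α β γ : ℤ) :
    ∑ m ∈ univ.erase (0 : Dual (ZMod 3) V), globalForm α β γ (profile S m) =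
      α * (2 * 3 ^ d * S.card - 2 * (S.card : ℤ) ^ 3)
        + β * (2 * 3 ^ d * S.card - 2 * (S.card : ℤ) ^ 2) + γ * (3 ^ d - 1) := by
  have hz : profile S 0 = (S.card, 0, 0) := by
    simp [profile, sliceCard, slice, show (0 : ZMod 3) ≠ 1 by decide,
      show (0 : ZMod 3) ≠ 2 by decide]
  have hq := sum_quadSum S
  have hc := sum_tripleSum_self hS
  simp only [quadSum_eq, tripleSum_self_eq] at hq hc
  rw [← add_sum_erase _ _ (mem_univ 0)] at hq hc
  have h0 := hz
  simp only [profile, Prod.mk.injEq] at h0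
  rw [h0.1, h0.2.1, h0.2.2, hV] at hq hc
  simp only [globalForm, sum_add_distrib, ← mul_sum, cubic, quad, profile, sum_const, nsmul_eq_mul]
  rw [card_erase_of_mem (mem_univ _), card_univ, card_dual, hV, eq_sub_of_add_eq' hq,
    eq_sub_of_add_eq' hc, Nat.cast_sub (Nat.one_le_pow _ _ (by norm_num))]
  simp only [cubicForm, quadForm]
  push_cast
  ring

theorem globalForm_eq_zero [Finite V] {d : ℕ} (hV : finrank (ZMod 3) V = d) {S : Finset V}
    (hS : LineFree S) {α β γ : ℤ}
    (hpos : ∀ m : Dual (ZMod 3) V, m ≠ 0 → 0 ≤ globalForm α β γ (profile S m))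
    (htot : α * (2 * 3 ^ d * S.card - 2 * (S.card : ℤ) ^ 3)
      + β * (2 * 3 ^ d * S.card - 2 * (S.card : ℤ) ^ 2) + γ * (3 ^ d - 1) ≤ 0) :
    ∀ m : Dual (ZMod 3) V, m ≠ 0 → globalForm α β γ (profile S m) = 0 := by
  classical
  have : Finite (Dual (ZMod 3) V) := DFunLike.finite _
  have := Fintype.ofFinite (Dual (ZMod 3) V)
  rw [← sum_globalForm hV hS] at htot
  have hpos' : ∀ m ∈ univ.erase (0 : Dual (ZMod 3) V), 0 ≤ globalForm α β γ (profile S m) :=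
    fun m hm => hpos m (ne_of_mem_erase hm)
  intro m hm
  exact (sum_eq_zero_iff_of_nonneg hpos').1 (le_antisymm htot (sum_nonneg hpos')) m
    (mem_erase.2 ⟨hm, mem_univ m⟩)

theorem cardBound_of_no_card {d n : ℕ} (h : ∀ (V : Type) [AddCommGroup V] [Module (ZMod 3) V]
    [Finite V], finrank (ZMod 3) V = d → ∀ S : Finset V, LineFree S → S.card ≠ n + 1) :
    CardBound d n := by
  intro V _ _ _ hV S hS
  by_contra! hn
  obtain ⟨T, hT, hcard⟩ := exists_subset_card_eq hn
  exact h V hV T (hS.mono hT) hcard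

theorem exists_dual_ne_zero [Finite V] {d : ℕ} (hV : finrank (ZMod 3) V = d + 1) :
    ∃ m : Dual (ZMod 3) V, m ≠ 0 := by
  have : Nontrivial (Dual (ZMod 3) V) :=
    Module.nontrivial_of_finrank_pos (R := ZMod 3) (by rw [Subspace.dual_finrank_eq]; omega)
  exact exists_ne 0

/-- The global averaging argument for a bound on the size of line-free sets. -/
theorem CardBound.succ {d n : ℕ} (h : CardBound d n) (N : ℕ) (γ : ℤ)
    (hcheck : ((triples (entriesLe n) (N + 1)).all
      fun a => decide (0 ≤ globalForm 1 0 γ a)) = true)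
    (htot : 2 * 3 ^ (d + 1) * (N + 1 : ℤ) - 2 * (N + 1 : ℤ) ^ 3 + γ * (3 ^ (d + 1) - 1) < 0) :
    CardBound (d + 1) N := by
  refine cardBound_of_no_card fun V _ _ _ hV S hS hN => ?_
  classical
  have : Finite (Dual (ZMod 3) V) := DFunLike.finite _
  have := Fintype.ofFinite (Dual (ZMod 3) V)
  have hsum := sum_globalForm hV hS 1 0 γ
  have hnn : 0 ≤ ∑ m ∈ univ.erase (0 : Dual (ZMod 3) V), globalForm 1 0 γ (profile S m) :=
    sum_nonneg fun m hm => of_decide_eq_true (List.all_eq_true.1 hcheck _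
      (profile_mem_triples h hV hS hN (ne_of_mem_erase hm)))
  rw [hsum, hN] at hnn
  push_cast at hnn
  linarith

end Global

section LowDimension

theorem cardBound_zero : CardBound 0 1 := by
  intro V _ _ _ hV S _
  have := Module.finrank_zero_iff.1 hV
  exact card_le_one_of_subsingleton S

theorem cardBound_one : CardBound 1 2 :=
  cardBound_zero.succ 2 0 (by decide +kernel) (by norm_num)

theorem cardBound_two : CardBound 2 4 :=
  cardBound_one.succ 4 2 (by decide +kernel) (by norm_num)

theorem cardBound_three : CardBound 3 9 :=
  cardBound_two.succ 9 16 (by decide +kernel) (by norm_num)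

/-- The slice sizes of caps in dimension three. -/
def validThree (a : ℕ × ℕ × ℕ) : Bool :=
  (a.1 + a.2.1 + a.2.2).ble 9 && entriesLe 4 a &&
    (!(a.1 + a.2.1 + a.2.2).beq 9 || prodIn [16, 27] a)

theorem validThree_rot (a : ℕ × ℕ × ℕ) : validThree (rot a) = validThree a := by
  rw [validThree, validThree, prodIn_rot,
    show (rot a).1 + (rot a).2.1 + (rot a).2.2 = a.1 + a.2.1 + a.2.2 by simp only [rot]; ring]
  simp only [entriesLe, rot]
  ac_rfl

theorem bound_three : Bound 3 validThree := by
  intro V _ _ _ hV S hS ℓ hℓ i j k hij hik hjk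
  have hle := fun x => cardBound_two.sliceCard_le hV hS hℓ x
  have hsum := sum_sliceCard_distinct S ℓ hij hik hjk
  have hcard := cardBound_three V hV S hS
  simp only [validThree, Bool.and_eq_true, Nat.ble_eq, entriesLe_iff, Bool.or_eq_true,
    Bool.not_eq_true', ← Bool.not_eq_true, Nat.beq_eq, or_iff_not_imp_left, not_not]
  refine ⟨⟨by omega, hle i, hle j, hle k⟩, fun h9 => ?_⟩
  have hN : S.card = 9 := by omega
  have hcheck : ((triples (entriesLe 4) 9).all fun a => decide (0 ≤ globalForm 1 3 0 a) &&
      (!decide (globalForm 1 3 0 a = 0) || prodIn [16, 27] a)) = true := by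
    decide +kernel
  have hmem := fun (m : Dual (ZMod 3) V) (hm : m ≠ 0) =>
    List.all_eq_true.1 hcheck _ (profile_mem_triples cardBound_two hV hS hN hm)
  simp only [Bool.and_eq_true, decide_eq_true_eq, Bool.or_eq_true, Bool.not_eq_true',
    decide_eq_false_iff_not] at hmem
  have hzero := globalForm_eq_zero hV hS (fun m hm => (hmem m hm).1) (by rw [hN]; norm_num) ℓ hℓ
  have h := (hmem ℓ hℓ).2.resolve_left (not_not.2 hzero)
  rw [prodIn_iff, ← sliceProd_eq_profile, sliceProd_eq S ℓ hij hik hjk] at h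
  exact prodIn_iff.2 h

end LowDimension

section Exclusion

variable {V : Type} [AddCommGroup V] [Module (ZMod 3) V]

/-- The products of the slice sizes of `S` along nonzero functionals lie in `L`. -/
def ProdsIn (S : Finset V) (L : List ℕ) : Prop :=
  ∀ m : Dual (ZMod 3) V, m ≠ 0 → sliceProd S m ∈ L

theorem ProdsIn.prodIn_sliceCard {S : Finset V} {L : List ℕ} (h : ProdsIn S L) (m : Dual (ZMod 3) V)
    (hm : m ≠ 0) (i j k : ZMod 3) (hij : i ≠ j) (hik : i ≠ k) (hjk : j ≠ k) :
    prodIn L (sliceCard S m i, sliceCard S m j, sliceCard S m k) = true :=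
  prodIn_iff.2 (sliceProd_eq S m hij hik hjk ▸ h m hm)

theorem sum_off_sliceProd [Fintype (Dual (ZMod 3) V)] (S : Finset V) {ℓ : Dual (ZMod 3) V}
    (hℓ : ℓ ≠ 0) (lam : ℕ → ℤ) :
    ∑ m ∈ off ℓ, lam (sliceProd S m) + (lam (sliceProd S 0) + 2 * lam (sliceProd S ℓ)) =
      ∑ m, lam (sliceProd S m) := by
  rw [← sum_off_add hℓ, sum_zmod_three, zero_smul, one_smul, sliceProd_smul S ℓ (by decide)]
  ring

variable [Finite V]

theorem prodsIn_of_cardBound {d n N : ℕ} (h : CardBound d n) (hV : finrank (ZMod 3) V = d + 1)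
    {S : Finset V} (hS : LineFree S) (hN : S.card = N) {L : List ℕ}
    (hcheck : ((triples (entriesLe n) N).all (prodIn L)) = true) : ProdsIn S L := by
  intro m hm
  rw [sliceProd_eq_profile, ← prodIn_iff]
  exact List.all_eq_true.1 hcheck _ (profile_mem_triples h hV hS hN hm)

theorem exists_of_sliceProd_eq {d n N : ℕ} (h : CardBound d n) (hV : finrank (ZMod 3) V = d + 1)
    {S : Finset V} (hS : LineFree S) (hN : S.card = N) {x y z : ℕ}
    (hperm : ((triples (entriesLe n) N).all
      fun a => !prodIn [x * y * z] a || isPerm x y z a) = true)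
    {m : Dual (ZMod 3) V} (hm : m ≠ 0) (hprod : sliceProd S m = x * y * z) :
    ∃ i j k : ZMod 3, i ≠ j ∧ i ≠ k ∧ j ≠ k ∧
      sliceCard S m i = x ∧ sliceCard S m j = y ∧ sliceCard S m k = z := by
  have h' := List.all_eq_true.1 hperm _ (profile_mem_triples h hV hS hN hm)
  simp only [Bool.or_eq_true, Bool.not_eq_true', ← Bool.not_eq_true, prodIn_iff,
    ← sliceProd_eq_profile, hprod, List.mem_singleton, not_true_eq_false, false_or] at h'
  exact exists_of_isPerm h'

/-- A direction with slices `x`, `y`, `z` is impossible when some certificate has negative total. -/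
theorem ProdsIn.exclude {d n N : ℕ} (h : CardBound d n) {v : ℕ × ℕ × ℕ → Bool} (hB : Bound d v)
    (hv : ∀ a, v (rot a) = v a) (hV : finrank (ZMod 3) V = d + 1) {S : Finset V}
    (hS : LineFree S) (hN : S.card = N) {L : List ℕ} (hL : ProdsIn S L) (w : Weights) (x y z : ℕ)
    (hperm : ((triples (entriesLe n) N).all
      fun a => !prodIn [x * y * z] a || isPerm x y z a) = true)
    (hgrid : gridAll v x y z (certificate w (fun _ => 0) (prodIn L)) = true)
    (htot : w.total (3 ^ (d + 1)) x y z < 0) : ProdsIn S (L.erase (x * y * z)) := by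
  intro m hm
  refine (List.mem_erase_of_ne fun hprod => ?_).2 (hL m hm)
  have : Finite (Dual (ZMod 3) V) := DFunLike.finite _
  have := Fintype.ofFinite (Dual (ZMod 3) V)
  obtain ⟨i, j, k, hij, hik, hjk, hi, hj, hk⟩ := exists_of_sliceProd_eq h hV hS hN hperm hm hprod
  have := total_nonneg hB hv hV hS (prodIn_rot L) hL.prodIn_sliceCard hm hij hik hjk hi hj hk w _
    hgrid
  simp only [sum_const_zero] at this
  linarith

end Exclusion

section Nineteen

variable {V : Type} [AddCommGroup V] [Module (ZMod 3) V] [Finite V]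

/-- The multipliers of the joint certificate for the types `(9, 8, 2)` and `(8, 7, 4)`. -/
def multiplier (p : ℕ) : ℤ :=
  if p = 252 then 180 else if p = 245 then 216 else if p = 240 then 222 else
    if p = 224 then 324 else if p = 192 then 620 else if p = 144 then 1019 else 0

/-- Indicator, up to sign, of the types that do not occur in a cap of size nineteen. -/
def badType (p : ℕ) : ℤ :=
  if p = 81 then 0 else if p = 144 then 0 else if p = 240 then 0 else if p = 252 then 0 else -1

theorem prodsIn_nineteen (hV : finrank (ZMod 3) V = 4) {S : Finset V} (hS : LineFree S)
    (hN : S.card = 19) : ProdsIn S [81, 144, 240, 252] := by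
  have : Finite (Dual (ZMod 3) V) := DFunLike.finite _
  have := Fintype.ofFinite (Dual (ZMod 3) V)
  have hL : ProdsIn S [189, 216, 225, 81, 144, 192, 224, 240, 245, 252] :=
    prodsIn_of_cardBound cardBound_three hV hS hN (by decide +kernel)
  replace hL : ProdsIn S [216, 225, 81, 144, 192, 224, 240, 245, 252] :=
    hL.exclude cardBound_three bound_three validThree_rot hV hS hN
      ⟨-3, -1, 2, 1, -3, 1, 2, 30⟩ 9 7 3 (by decide +kernel) (by decide +kernel)
      (by decide +kernel)
  replace hL : ProdsIn S [225, 81, 144, 192, 224, 240, 245, 252] :=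
    hL.exclude cardBound_three bound_three validThree_rot hV hS hN
      ⟨-12, -4, 3, 1, 0, 1, 3, 16⟩ 9 6 4 (by decide +kernel) (by decide +kernel)
      (by decide +kernel)
  replace hL : ProdsIn S [81, 144, 192, 224, 240, 245, 252] :=
    hL.exclude cardBound_three bound_three validThree_rot hV hS hN
      ⟨-3, 1, -2, 1, -3, 2, 1, 130⟩ 9 5 5 (by decide +kernel) (by decide +kernel)
      (by decide +kernel)
  by_cases h81 : ∃ ℓ : Dual (ZMod 3) V, ℓ ≠ 0 ∧ sliceProd S ℓ = 9 * 9 * 1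
  · obtain ⟨ℓ, hℓ, hprod⟩ := h81
    obtain ⟨i, j, k, hij, hik, hjk, hi, hj, hk⟩ :=
      exists_of_sliceProd_eq cardBound_three hV hS hN (by decide +kernel) hℓ hprod
    have htot := total_nonneg bound_three validThree_rot hV hS (prodIn_rot _) hL.prodIn_sliceCard hℓ hij hik
      hjk hi hj hk ⟨3, 0, 3, 0, 0, 0, 12, 0⟩ badType (by decide +kernel)
    rw [show Weights.total ⟨3, 0, 3, 0, 0, 0, 12, 0⟩ (3 ^ (3 + 1)) (9 : ℕ) (9 : ℕ) (1 : ℕ) = 0 by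
      decide +kernel] at htot
    have hnonpos : ∀ m ∈ off ℓ, badType (sliceProd S m) ≤ 0 := by
      intro m _
      unfold badType
      split_ifs <;> decide
    have hzero := (sum_eq_zero_iff_of_nonpos hnonpos).1
      (le_antisymm (sum_nonpos hnonpos) (by linarith))
    intro m hm
    by_cases hoff : m ∈ off ℓ
    · have := hzero m hoff
      have hmL := hL m hm
      simp only [List.mem_cons, List.not_mem_nil, or_false] at hmL ⊢
      unfold badType at this
      split_ifs at this <;> simp_all
    · simp only [mem_off, not_forall, not_not] at hoff
      obtain ⟨t, rfl⟩ := hoff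
      rw [sliceProd_smul S ℓ (by rintro rfl; exact hm (zero_smul _ _)), hprod]
      decide
  replace hL : ProdsIn S [144, 192, 224, 240, 245, 252] := fun m hm =>
    (List.mem_cons.1 (hL m hm)).resolve_left fun h => h81 ⟨m, hm, h⟩
  exfalso
  by_cases h144 : ∃ ℓ : Dual (ZMod 3) V, ℓ ≠ 0 ∧ sliceProd S ℓ = 9 * 8 * 2
  · by_cases h224 : ∃ ℓ : Dual (ZMod 3) V, ℓ ≠ 0 ∧ sliceProd S ℓ = 8 * 7 * 4
    · obtain ⟨ℓ, hℓ, hprod⟩ := h144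
      obtain ⟨ℓ', hℓ', hprod'⟩ := h224
      obtain ⟨i, j, k, hij, hik, hjk, hi, hj, hk⟩ :=
        exists_of_sliceProd_eq cardBound_three hV hS hN (by decide +kernel) hℓ hprod
      obtain ⟨i', j', k', hij', hik', hjk', hi', hj', hk'⟩ :=
        exists_of_sliceProd_eq cardBound_three hV hS hN (by decide +kernel) hℓ' hprod'
      have htot := total_nonneg bound_three validThree_rot hV hS (prodIn_rot _) hL.prodIn_sliceCard hℓ
        hij hik hjk hi hj hk ⟨-20, 0, -11, 3, -45, 16, 20, -410⟩ multiplier (by decide +kernel)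
      have htot' := total_nonneg bound_three validThree_rot hV hS (prodIn_rot _) hL.prodIn_sliceCard hℓ'
        hij' hik' hjk' hi' hj' hk' ⟨23, -2, 33, 0, 45, 2, 10, 424⟩ (fun p => -multiplier p)
        (by decide +kernel)
      have hsum := sum_off_sliceProd S hℓ multiplier
      have hsum' := sum_off_sliceProd S hℓ' multiplier
      rw [hprod, show multiplier (9 * 8 * 2) = 1019 by decide] at hsum
      rw [hprod', show multiplier (8 * 7 * 4) = 324 by decide] at hsum'
      simp only [sum_neg_distrib] at htot'
      have hneg : Weights.total ⟨-20, 0, -11, 3, -45, 16, 20, -410⟩ (3 ^ (3 + 1))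
          (9 : ℕ) (8 : ℕ) (2 : ℕ) + Weights.total ⟨23, -2, 33, 0, 45, 2, 10, 424⟩ (3 ^ (3 + 1))
          (8 : ℕ) (7 : ℕ) (4 : ℕ) < 6 * 1019 - 6 * 324 := by decide +kernel
      linarith
    · have hL' : ProdsIn S [144, 192, 240, 245, 252] := by
        intro m hm
        have h := hL m hm
        have : sliceProd S m ≠ 224 := fun h => h224 ⟨m, hm, h⟩
        simp only [List.mem_cons] at h ⊢
        tauto
      obtain ⟨ℓ, hℓ, hprod⟩ := h144
      have := hL'.exclude cardBound_three bound_three validThree_rot hV hS hN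
        ⟨-1, -1, -1, 1, -1, 0, 3, 45⟩ 9 8 2 (by decide +kernel) (by decide +kernel)
        (by decide +kernel) ℓ hℓ
      rw [hprod] at this
      revert this
      decide
  · replace hL : ProdsIn S [192, 224, 240, 245, 252] := fun m hm =>
      (List.mem_cons.1 (hL m hm)).resolve_left fun h => h144 ⟨m, hm, h⟩
    replace hL : ProdsIn S [224, 240, 245, 252] :=
      hL.exclude cardBound_three bound_three validThree_rot hV hS hN
        ⟨0, 0, 0, 0, 0, -1, 0, 0⟩ 8 8 3 (by decide +kernel) (by decide +kernel)
        (by decide +kernel)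
    have hcheck : ((triples (entriesLe 9) 19).all fun a => !prodIn [224, 240, 245, 252] a ||
        decide (0 < globalForm 589 2660 0 a)) = true := by
      decide +kernel
    have hpos : ∀ m : Dual (ZMod 3) V, m ≠ 0 → 0 < globalForm 589 2660 0 (profile S m) := by
      intro m hm
      have h := List.all_eq_true.1 hcheck _ (profile_mem_triples cardBound_three hV hS hN hm)
      simp only [Bool.or_eq_true, Bool.not_eq_true', decide_eq_true_eq] at h
      refine h.resolve_left ?_
      rw [Bool.not_eq_false, prodIn_iff, ← sliceProd_eq_profile]
      exact hL m hm
    obtain ⟨m, hm⟩ := exists_dual_ne_zero hV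
    exact (hpos m hm).ne' (globalForm_eq_zero hV hS (fun m hm => (hpos m hm).le)
      (by rw [hN]; norm_num) m hm)

end Nineteen

section Shrinking

variable {V : Type} [AddCommGroup V] [Module (ZMod 3) V] [Finite V]

/-- Decreasing any positive entry by one gives a triple with product in `L`. -/
def shrinkIn (L : List ℕ) (a : ℕ × ℕ × ℕ) : Bool :=
  (a.1.beq 0 || prodIn L (a.1 - 1, a.2.1, a.2.2)) &&
    (a.2.1.beq 0 || prodIn L (a.1, a.2.1 - 1, a.2.2)) &&
      (a.2.2.beq 0 || prodIn L (a.1, a.2.1, a.2.2 - 1))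

theorem prodsIn_succ {d n N : ℕ} (h : CardBound d n) (hV : finrank (ZMod 3) V = d + 1)
    {S : Finset V} (hS : LineFree S) (hN : S.card = N + 1) {L L' : List ℕ}
    (hL : ∀ T ⊆ S, T.card = N → ProdsIn T L)
    (hcheck : ((triples (entriesLe n) (N + 1)).all fun a => !shrinkIn L a || prodIn L' a) = true) :
    ProdsIn S L' := by
  intro m hm
  have h' := List.all_eq_true.1 hcheck _ (profile_mem_triples h hV hS hN hm)
  rw [sliceProd_eq_profile, ← prodIn_iff]
  simp only [Bool.or_eq_true, Bool.not_eq_true', ← Bool.not_eq_true] at h'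
  refine h'.resolve_left (not_not.2 ?_)
  have h01 : (0 : ZMod 3) ≠ 1 := by decide
  have h02 : (0 : ZMod 3) ≠ 2 := by decide
  have h12 : (1 : ZMod 3) ≠ 2 := by decide
  have hsum := (sum_sliceCard S m).trans hN
  have key : ∀ x y z, x ≤ sliceCard S m 0 → y ≤ sliceCard S m 1 → z ≤ sliceCard S m 2 →
      x + y + z = N → prodIn L (x, y, z) = true := by
    intro x y z hx hy hz hxyz
    obtain ⟨T, hT, hcard, rfl, rfl, rfl⟩ := exists_subset_sliceCard S m h01 h02 h12 hx hy hz
    exact (hL T hT (hcard.trans hxyz)).prodIn_sliceCard m hm _ _ _ h01 h02 h12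
  simp only [shrinkIn, profile, Bool.and_eq_true, Bool.or_eq_true, Nat.beq_eq]
  refine ⟨⟨?_, ?_⟩, ?_⟩ <;> rw [or_iff_not_imp_left] <;> intro hne <;>
    apply key <;> omega

end Shrinking

section MiddleDimension

theorem prodsIn_twenty {V : Type} [AddCommGroup V] [Module (ZMod 3) V] [Finite V]
    (hV : finrank (ZMod 3) V = 4) {S : Finset V} (hS : LineFree S)
    (hN : S.card = 20) : ProdsIn S [162, 288] :=
  prodsIn_succ cardBound_three hV hS hN
    (fun _ hT hcard => prodsIn_nineteen hV (hS.mono hT) hcard) (by decide +kernel)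

theorem cardBound_four : CardBound 4 20 := by
  refine cardBound_of_no_card fun V _ _ _ hV S hS hN => ?_
  have h : ProdsIn S [] := prodsIn_succ cardBound_three hV hS hN
    (fun _ hT hcard => prodsIn_twenty hV (hS.mono hT) hcard) (by decide +kernel)
  obtain ⟨m, hm⟩ := exists_dual_ne_zero hV
  exact List.not_mem_nil (h m hm)

/-- The slice sizes of caps in dimension four. -/
def validFour (a : ℕ × ℕ × ℕ) : Bool :=
  (a.1 + a.2.1 + a.2.2).ble 20 && entriesLe 9 a &&
    (!(a.1 + a.2.1 + a.2.2).beq 19 || prodIn [81, 144, 240, 252] a) &&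
      (!(a.1 + a.2.1 + a.2.2).beq 20 || prodIn [162, 288] a)

theorem validFour_rot (a : ℕ × ℕ × ℕ) : validFour (rot a) = validFour a := by
  rw [validFour, validFour, prodIn_rot, prodIn_rot,
    show (rot a).1 + (rot a).2.1 + (rot a).2.2 = a.1 + a.2.1 + a.2.2 by simp only [rot]; ring,
    entriesLe_rot]

theorem bound_four : Bound 4 validFour := by
  intro V _ _ _ hV S hS ℓ hℓ i j k hij hik hjk
  have hle := fun x => cardBound_three.sliceCard_le hV hS hℓ x
  have hsum := sum_sliceCard_distinct S ℓ hij hik hjk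
  have hcard := cardBound_four V hV S hS
  simp only [validFour, Bool.and_eq_true, Nat.ble_eq, entriesLe_iff, Bool.or_eq_true,
    Bool.not_eq_true', ← Bool.not_eq_true, Nat.beq_eq, or_iff_not_imp_left, not_not, hsum]
  exact ⟨⟨⟨hcard, hle i, hle j, hle k⟩,
    fun h => (prodsIn_nineteen hV hS h).prodIn_sliceCard ℓ hℓ i j k hij hik hjk⟩,
    fun h => (prodsIn_twenty hV hS h).prodIn_sliceCard ℓ hℓ i j k hij hik hjk⟩

/-- Products of three numbers of sum `45` and at most `20`. -/
def fortyFiveProducts : List ℕ :=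
  [2720, 2880, 2907, 2916, 3000, 3040, 3060, 3080, 3120, 3135, 3168, 3179, 3192, 3211, 3240, 3264,
    3276, 3315, 3328, 3332, 3360, 3375]

theorem prodsIn_fortyFive {V : Type} [AddCommGroup V] [Module (ZMod 3) V] [Finite V]
    (hV : finrank (ZMod 3) V = 5) {S : Finset V} (hS : LineFree S)
    (hN : S.card = 45) : ProdsIn S [2916, 3375] := by
  have hL : ProdsIn S (2000 :: 2280 :: 2520 :: 2527 :: 2736 :: fortyFiveProducts) :=
    prodsIn_of_cardBound cardBound_four hV hS hN (by decide +kernel)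
  replace hL : ProdsIn S (2280 :: 2520 :: 2527 :: 2736 :: fortyFiveProducts) :=
    hL.exclude cardBound_four bound_four validFour_rot hV hS hN
      ⟨-9, -2, -9, -2, 7, -1, 9, 288⟩ 20 20 5 (by decide +kernel) (by decide +kernel)
      (by decide +kernel)
  replace hL : ProdsIn S (2520 :: 2527 :: 2736 :: fortyFiveProducts) :=
    hL.exclude cardBound_four bound_four validFour_rot hV hS hN
      ⟨-4, -1, 5, 0, 6, 0, 6, 50⟩ 20 19 6 (by decide +kernel) (by decide +kernel)
      (by decide +kernel)
  replace hL : ProdsIn S (2527 :: 2736 :: fortyFiveProducts) :=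
    hL.exclude cardBound_four bound_four validFour_rot hV hS hN
      ⟨-23, -4, 24, 2, 13, 2, 13, 218⟩ 20 18 7 (by decide +kernel) (by decide +kernel)
      (by decide +kernel)
  replace hL : ProdsIn S (2736 :: fortyFiveProducts) :=
    hL.exclude cardBound_four bound_four validFour_rot hV hS hN
      ⟨3, 0, 11, 1, 3, 0, 5, -19⟩ 19 19 7 (by decide +kernel) (by decide +kernel)
      (by decide +kernel)
  replace hL : ProdsIn S fortyFiveProducts :=
    hL.exclude cardBound_four bound_four validFour_rot hV hS hN
      ⟨1, -1, 49, 5, 41, 5, 23, -66⟩ 19 18 8 (by decide +kernel) (by decide +kernel)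
      (by decide +kernel)
  have hcheck : ((triples (entriesLe 20) 45).all fun a =>
      !prodIn fortyFiveProducts a ||
      (decide (0 ≤ globalForm 1 9 0 a) &&
        (!decide (globalForm 1 9 0 a = 0) || prodIn [2916, 3375] a))) = true := by
    decide +kernel
  have hmem : ∀ m : Dual (ZMod 3) V, m ≠ 0 → 0 ≤ globalForm 1 9 0 (profile S m) ∧
      (globalForm 1 9 0 (profile S m) = 0 → sliceProd S m ∈ [2916, 3375]) := by
    intro m hm
    have h := List.all_eq_true.1 hcheck _ (profile_mem_triples cardBound_four hV hS hN hm)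
    have hm' := hL m hm
    rw [sliceProd_eq_profile, ← prodIn_iff] at hm' ⊢
    rw [hm'] at h
    simpa [← Bool.not_eq_true, or_iff_not_imp_left] using h
  intro m hm
  exact (hmem m hm).2 (globalForm_eq_zero hV hS (fun m hm => (hmem m hm).1)
    (by rw [hN]; norm_num) m hm)

theorem cardBound_five : CardBound 5 45 := by
  refine cardBound_of_no_card fun V _ _ _ hV S hS hN => ?_
  have h : ProdsIn S [] := prodsIn_succ cardBound_four hV hS hN
    (fun _ hT hcard => prodsIn_fortyFive hV (hS.mono hT) hcard) (by decide +kernel)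
  obtain ⟨m, hm⟩ := exists_dual_ne_zero hV
  exact List.not_mem_nil (h m hm)

/-- The slice sizes of caps in dimension five. -/
def validFive (a : ℕ × ℕ × ℕ) : Bool :=
  (a.1 + a.2.1 + a.2.2).ble 45 && entriesLe 20 a &&
    (!(a.1 + a.2.1 + a.2.2).beq 45 || prodIn [2916, 3375] a)

theorem validFive_rot (a : ℕ × ℕ × ℕ) : validFive (rot a) = validFive a := by
  rw [validFive, validFive, prodIn_rot,
    show (rot a).1 + (rot a).2.1 + (rot a).2.2 = a.1 + a.2.1 + a.2.2 by simp only [rot]; ring,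
    entriesLe_rot]

theorem bound_five : Bound 5 validFive := by
  intro V _ _ _ hV S hS ℓ hℓ i j k hij hik hjk
  have hle := fun x => cardBound_four.sliceCard_le hV hS hℓ x
  have hsum := sum_sliceCard_distinct S ℓ hij hik hjk
  have hcard := cardBound_five V hV S hS
  simp only [validFive, Bool.and_eq_true, Nat.ble_eq, entriesLe_iff, Bool.or_eq_true,
    Bool.not_eq_true', ← Bool.not_eq_true, Nat.beq_eq, or_iff_not_imp_left, not_not, hsum]
  exact ⟨⟨hcard, hle i, hle j, hle k⟩,
    fun h => (prodsIn_fortyFive hV hS h).prodIn_sliceCard ℓ hℓ i j k hij hik hjk⟩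

end MiddleDimension

section Extremal

theorem isPerm_iff {x y z : ℕ} {a : ℕ × ℕ × ℕ} :
    isPerm x y z a = true ↔ ({a.1, a.2.1, a.2.2} : Multiset ℕ) = {x, y, z} := by
  obtain ⟨p, q, r⟩ := a
  change _ ↔ (([p, q, r] : List ℕ) : Multiset ℕ) = ([x, y, z] : List ℕ)
  rw [Multiset.coe_eq_coe, ← List.mem_permutations']
  simp only [isPerm, List.contains_iff_mem, List.mem_cons, Prod.mk.injEq, List.not_mem_nil,
    or_false, List.permutations', List.permutations'Aux, List.flatMap_cons, List.flatMap_nil,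
    List.map_cons, List.map_nil, List.append_nil, List.cons_append, List.nil_append,
    List.cons.injEq, and_true]
  tauto

theorem isPerm_rot (x y z : ℕ) (a : ℕ × ℕ × ℕ) : isPerm x y z (rot a) = isPerm x y z a := by
  rw [Bool.eq_iff_iff, isPerm_iff, isPerm_iff,
    show ({(rot a).1, (rot a).2.1, (rot a).2.2} : Multiset ℕ) = {a.1, a.2.1, a.2.2} from
      Multiset.coe_eq_coe.2 (List.perm_append_comm (l₁ := [a.2.1, a.2.2]) (l₂ := [a.1]))]

/-- The rows of a grid attaining equality in the estimate for slices of sizes `45`, `45`, `22`. -/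
def tightPattern (a b c : ℕ × ℕ × ℕ) : Bool :=
  (isPerm 15 15 15 a && isPerm 15 15 15 b) ||
    (isPerm 18 18 9 a && isPerm 18 18 9 b && isPerm 9 9 4 c && (isPerm 45 45 22 (classA a b c) ||
      isPerm 45 45 22 (classB a b c) || isPerm 45 45 22 (classC a b c)))

/-- Nonnegativity of a weighted value, with equality only in the tight case. -/
def tightCertificate (w : Weights) (a b c : ℕ × ℕ × ℕ) : Bool :=
  decide (0 ≤ w.value a b c) && (!decide (w.value a b c = 0) || tightPattern a b c)

theorem gridAll_tightCertificate :
    gridAll validFive 45 45 22 (tightCertificate ⟨5, 0, 5, 0, 0, 0, 2, 0⟩) = true := by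
  decide +kernel

theorem rotInvariant_tightCertificate (w : Weights) : RotInvariant (tightCertificate w) := by
  intro a b c
  have hA := class_rot_left a b c
  have hB := class_rot_right a b c
  simp only [tightCertificate, tightPattern, (w.value_rot a b c).1, (w.value_rot a b c).2, hA.1,
    hA.2.1, hA.2.2, hB.1, hB.2.1, hB.2.2, isPerm_rot]
  constructor <;> ac_rfl

variable {V : Type} [AddCommGroup V] [Module (ZMod 3) V]

/-- Each transversal class consists of the slices along a functional in the same pencil. -/
theorem exists_profile_of_class (S : Finset V) (ℓ m : Dual (ZMod 3) V) {i j k : ZMod 3}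
    (hij : i ≠ j) (hik : i ≠ k) (hjk : j ≠ k) {P : ℕ × ℕ × ℕ → Prop}
    (hP : ∀ a, P (rot a) → P a)
    (h : P (classA (profile (slice S ℓ i) m) (profile (slice S ℓ j) m) (profile (slice S ℓ k) m)) ∨
      P (classB (profile (slice S ℓ i) m) (profile (slice S ℓ j) m) (profile (slice S ℓ k) m)) ∨
      P (classC (profile (slice S ℓ i) m) (profile (slice S ℓ j) m)
        (profile (slice S ℓ k) m))) :
    ∃ s : ZMod 3, P (profile S (m + s • ℓ)) := by
  obtain ⟨s, hs⟩ := exists_class_direction hij hik hjk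
  have htranslate : ∀ (f : ZMod 3 → ℕ) (c : ZMod 3), P (f (0 + c), f (1 + c), f (2 + c)) →
      P (f 0, f 1, f 2) := by
    intro f c
    revert c
    exact Fin.forall_fin_succ.2 ⟨id, Fin.forall_fin_two.2 ⟨hP (f 0, f 1, f 2), fun h =>
      hP (f 0, f 1, f 2) (hP (f 1, f 2, f 0) h)⟩⟩
  have key : ∀ t : ZMod 3, ∀ f : ZMod 3 → ℕ, f = (fun x => sliceCard (slice S ℓ i) m x +
      sliceCard (slice S ℓ j) m (x + t) + sliceCard (slice S ℓ k) m (x + 2 * t)) →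
      P (f 0, f 1, f 2) → ∃ s : ZMod 3, P (profile S (m + s • ℓ)) := by
    rintro t f rfl h
    refine ⟨t * s, htranslate _ (t * s * i) ?_⟩
    simpa only [class_eq S ℓ m hij hik hjk (hs t)] using h
  rcases h with h | h | h
  · exact key 0 _ rfl h
  · exact key 1 _ rfl h
  · exact key 2 _ rfl h

/-- The cells cut out by a functional with slices of sizes `45`, `45`, `22` and any other one. -/
theorem tight_of_mem_off [Finite V] [Fintype (Dual (ZMod 3) V)] (hV : finrank (ZMod 3) V = 6)
    {S : Finset V} (hS : LineFree S) {ℓ : Dual (ZMod 3) V} (hℓ : ℓ ≠ 0) {i j k : ZMod 3}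
    (hij : i ≠ j) (hik : i ≠ k) (hjk : j ≠ k) (hi : sliceCard S ℓ i = 45)
    (hj : sliceCard S ℓ j = 45) (hk : sliceCard S ℓ k = 22) {m : Dual (ZMod 3) V}
    (hm : m ∈ off ℓ) :
    tightPattern (profile (slice S ℓ i) m) (profile (slice S ℓ j) m) (profile (slice S ℓ k) m)
      = true := by
  have hgrid : ∀ m ∈ off ℓ, tightCertificate ⟨5, 0, 5, 0, 0, 0, 2, 0⟩ (profile (slice S ℓ i) m)
      (profile (slice S ℓ j) m) (profile (slice S ℓ k) m) = true := by
    intro m hm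
    have hrow : ∀ n : ZMod 3, validFive (profile (slice S ℓ n) m) = true := fun n =>
      bound_five.apply_slice hV hS hℓ (mem_off.1 hm) n (by decide) (by decide) (by decide)
    exact gridAll_apply validFive_rot (rotInvariant_tightCertificate _) gridAll_tightCertificate
      _ _ _ (hrow i) (hrow j) (hrow k) (by rw [← hi]; exact sum_sliceCard _ _)
      (by rw [← hj]; exact sum_sliceCard _ _) (by rw [← hk]; exact sum_sliceCard _ _)
      (linesValid_of_mem_off bound_five hV hS hℓ hm hij hik hjk)
  simp only [tightCertificate, Bool.and_eq_true, decide_eq_true_eq, Bool.or_eq_true,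
    Bool.not_eq_true', decide_eq_false_iff_not, ← imp_iff_not_or] at hgrid
  refine (hgrid m hm).2 ((sum_eq_zero_iff_of_nonneg fun m hm => (hgrid m hm).1).1 ?_ m hm)
  rw [sum_value_off _ hℓ hS hij hik hjk, hi, hj, hk, hV]
  norm_num [Weights.total]

/-- Among nine cell sizes from `4`, `9`, `18` with sum `112` and lines of at most `45` points, some
parallel class is extremal. -/
theorem extremal_class_of_cells :
    (([4, 9, 18].product ([4, 9, 18].product [4, 9, 18])).all fun a =>
      ([4, 9, 18].product ([4, 9, 18].product [4, 9, 18])).all fun b =>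
        ([4, 9, 18].product ([4, 9, 18].product [4, 9, 18])).all fun c =>
          !(a.1 + a.2.1 + a.2.2 + (b.1 + b.2.1 + b.2.2) + (c.1 + c.2.1 + c.2.2)).beq 112 ||
          !(entriesLe 45 (a.1 + a.2.1 + a.2.2, b.1 + b.2.1 + b.2.2, c.1 + c.2.1 + c.2.2) &&
            entriesLe 45 (classA a b c) && entriesLe 45 (classB a b c) &&
            entriesLe 45 (classC a b c)) ||
          isPerm 45 45 22 (a.1 + a.2.1 + a.2.2, b.1 + b.2.1 + b.2.2, c.1 + c.2.1 + c.2.2) ||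
          isPerm 45 45 22 (classA a b c) || isPerm 45 45 22 (classB a b c) ||
          isPerm 45 45 22 (classC a b c)) = true := by
  decide +kernel

end Extremal

section Pencils

variable {V : Type} [AddCommGroup V] [Module (ZMod 3) V]

theorem span_pair_add_smul {M : Type*} [AddCommGroup M] [Module (ZMod 3) M] (u v : M)
    (s : ZMod 3) : Submodule.span (ZMod 3) {u, v + s • u} = Submodule.span (ZMod 3) {u, v} := by
  apply le_antisymm <;> rw [Submodule.span_le, Set.pair_subset_iff] <;>
    refine ⟨Submodule.subset_span (by simp), Submodule.mem_span_pair.2 ?_⟩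
  · exact ⟨s, 1, by module⟩
  · exact ⟨-s, 1, by module⟩

theorem mem_off_of_linearIndependent [Fintype (Dual (ZMod 3) V)] {ℓ m : Dual (ZMod 3) V}
    (h : LinearIndependent (ZMod 3) ![ℓ, m]) : m ∈ off ℓ :=
  mem_off.2 fun k hk => (LinearIndependent.pair_iff' (h.ne_zero 0)).1 h k hk.symm

/-- The pencil spanned by two functionals whose cells all have sizes `4`, `9` or `18` contains a
functional with slices of sizes `45`, `45`, `22`. -/
theorem exists_extremal_of_cells [Finite V] (hV : finrank (ZMod 3) V = 6) {S : Finset V}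
    (hS : LineFree S) (hN : S.card = 112) {ℓ m : Dual (ZMod 3) V}
    (hlm : LinearIndependent (ZMod 3) ![ℓ, m])
    (hcells : ∀ x y, sliceCard (slice S ℓ x) m y ∈ [4, 9, 18]) :
    ∃ u v : Dual (ZMod 3) V, LinearIndependent (ZMod 3) ![u, v] ∧
      Submodule.span (ZMod 3) {u, v} = Submodule.span (ZMod 3) {ℓ, m} ∧
      isPerm 45 45 22 (profile S u) = true ∧
      ∀ x y, sliceCard (slice S u x) v y ∈ [4, 9, 18] := by
  have : Finite (Dual (ZMod 3) V) := DFunLike.finite _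
  have := Fintype.ofFinite (Dual (ZMod 3) V)
  have hle : ∀ n : Dual (ZMod 3) V, n ≠ 0 → entriesLe 45 (profile S n) = true := fun n hn =>
    entriesLe_iff.2 ⟨cardBound_five.sliceCard_le hV hS hn 0,
      cardBound_five.sliceCard_le hV hS hn 1, cardBound_five.sliceCard_le hV hS hn 2⟩
  have hrow : ∀ x, (profile (slice S ℓ x) m).1 + (profile (slice S ℓ x) m).2.1 +
      (profile (slice S ℓ x) m).2.2 = sliceCard S ℓ x := fun x => sum_sliceCard _ _
  have hmem : ∀ x, profile (slice S ℓ x) m ∈ [4, 9, 18].product ([4, 9, 18].product [4, 9, 18]) :=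
    fun x => List.pair_mem_product.2 ⟨hcells x 0, List.pair_mem_product.2
      ⟨hcells x 1, hcells x 2⟩⟩
  have h01 : (0 : ZMod 3) ≠ 1 := by decide
  have h02 : (0 : ZMod 3) ≠ 2 := by decide
  have h12 : (1 : ZMod 3) ≠ 2 := by decide
  have hclass : ∀ {P : ℕ × ℕ × ℕ → Prop}, _ → _ → _ := fun {P} =>
    exists_profile_of_class S ℓ m h01 h02 h12 (P := P)
  have hbound := mt (hclass (P := fun a => entriesLe 45 a ≠ true) fun a h => by
    rwa [entriesLe_rot] at h) (by
      rintro ⟨s, hs⟩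
      exact hs (hle _ (ne_zero_of_mem_off
        (add_smul_mem_off (mem_off_of_linearIndependent hlm) s))))
  simp only [not_or, not_not] at hbound
  have h := List.all_eq_true.1 (List.all_eq_true.1 (List.all_eq_true.1 extremal_class_of_cells _
    (hmem 0)) _ (hmem 1)) _ (hmem 2)
  have hle' : entriesLe 45 (sliceCard S ℓ 0, sliceCard S ℓ 1, sliceCard S ℓ 2) = true :=
    hle ℓ (hlm.ne_zero 0)
  simp only [hrow, hbound, sum_sliceCard, hN, hle', Bool.and_self, Bool.not_true, Bool.or_false,
    Bool.false_or, Nat.beq_refl, Bool.or_eq_true, or_assoc] at h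
  rcases h with h | h
  · exact ⟨ℓ, m, hlm, rfl, h, hcells⟩
  · obtain ⟨s, hs⟩ := hclass (P := fun a => isPerm 45 45 22 a = true)
      (fun a h => by rwa [isPerm_rot] at h) h
    refine ⟨m + s • ℓ, ℓ, ?_, ?_, hs, fun x y => ?_⟩
    · rw [LinearIndependent.pair_symm_iff, add_comm]
      exact (LinearIndependent.pair_add_smul_right_iff s).2 hlm
    · rw [Set.pair_comm, span_pair_add_smul]
    · rw [slice_add_smul]
      exact hcells _ _

/-- If the cells cut out by an extremal functional and another one have sizes `4`, `9` or `18`, the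
pencil contains a second extremal functional. -/
theorem exists_extremal_add_smul [Finite V] (hV : finrank (ZMod 3) V = 6) {S : Finset V}
    (hS : LineFree S) {u v : Dual (ZMod 3) V} (huv : LinearIndependent (ZMod 3) ![u, v])
    (hu : isPerm 45 45 22 (profile S u) = true)
    (hcells : ∀ x y, sliceCard (slice S u x) v y ∈ [4, 9, 18]) :
    ∃ s : ZMod 3, isPerm 45 45 22 (profile S (v + s • u)) = true := by
  have : Finite (Dual (ZMod 3) V) := DFunLike.finite _
  have := Fintype.ofFinite (Dual (ZMod 3) V)
  obtain ⟨i, j, k, hij, hik, hjk, hi, hj, hk⟩ := exists_of_isPerm hu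
  have hu' : u ≠ 0 := huv.ne_zero 0
  have h := tight_of_mem_off hV hS hu' hij hik hjk hi hj hk
    (mem_off_of_linearIndependent huv)
  simp only [tightPattern, Bool.or_eq_true, Bool.and_eq_true] at h
  rcases h with ⟨h, -⟩ | ⟨-, h⟩
  · obtain ⟨x, -, -, -, -, -, hx, -⟩ := exists_of_isPerm h
    have := hcells i x
    simp [hx] at this
  · exact exists_profile_of_class S u v hij hik hjk (P := fun a => isPerm 45 45 22 a = true)
      (fun a h => by rwa [isPerm_rot] at h) (by rwa [or_assoc] at h)

/-- The cells cut out by two independent functionals with slices of sizes `45`, `45`, `22`. -/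
theorem isPerm_of_extremal [Finite V] (hV : finrank (ZMod 3) V = 6) {S : Finset V}
    (hS : LineFree S) {u v : Dual (ZMod 3) V} (huv : LinearIndependent (ZMod 3) ![u, v])
    (hu : isPerm 45 45 22 (profile S u) = true) (hv : isPerm 45 45 22 (profile S v) = true) :
    ∃ i j k : ZMod 3, i ≠ j ∧ i ≠ k ∧ j ≠ k ∧ isPerm 18 18 9 (profile (slice S u i) v) = true ∧
      isPerm 18 18 9 (profile (slice S u j) v) = true ∧
      isPerm 9 9 4 (profile (slice S u k) v) = true := by
  have : Finite (Dual (ZMod 3) V) := DFunLike.finite _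
  have := Fintype.ofFinite (Dual (ZMod 3) V)
  obtain ⟨i, j, k, hij, hik, hjk, hi, hj, hk⟩ := exists_of_isPerm hu
  have hu' : u ≠ 0 := huv.ne_zero 0
  have h := tight_of_mem_off hV hS hu' hij hik hjk hi hj hk
    (mem_off_of_linearIndependent huv)
  simp only [tightPattern, Bool.or_eq_true, Bool.and_eq_true] at h
  rcases h with ⟨hA, hB⟩ | ⟨⟨⟨hA, hB⟩, hC⟩, -⟩
  · obtain ⟨-, -, x, -, -, -, -, -, hx⟩ := exists_of_isPerm hv
    have hsum := sliceCard_add_smul S u v 0 x hij hik hjk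
    have hconst : ∀ A : Finset V, isPerm 15 15 15 (profile A v) = true →
        sliceCard A v x = 15 := by
      intro A hA
      obtain ⟨a, b, c, hab, hac, hbc, ha, hb, hc⟩ := exists_of_isPerm hA
      have hx := univ_zmod_three hab hac hbc ▸ mem_univ x
      simp only [mem_insert, mem_singleton] at hx
      rcases hx with rfl | rfl | rfl <;> assumption
    simp only [zero_smul, add_zero, zero_mul, sub_zero, hx, hconst _ hA, hconst _ hB] at hsum
    omega
  · exact ⟨i, j, k, hij, hik, hjk, hA, hB, hC⟩

end Pencils

section Multisets

variable {n : ℕ} {S : Finset (Fin n → ZMod 3)}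

theorem lineFree_of_isCap (hS : IsCap S) : LineFree S := by
  intro a ha b hb c hc h
  have key : ∀ u v : Fin n → ZMod 3, u + u + v = 0 → u = v := fun u v huv => by
    rw [← sub_eq_zero, show u - v = (3 : ZMod 3) • u - (u + u + v) by module, huv,
      show (3 : ZMod 3) = 0 from rfl, zero_smul, sub_zero]
  by_cases hab : a = b
  · subst hab
    exact ⟨rfl, key _ _ h⟩
  by_cases hac : a = c
  · subst hac
    exact absurd (key a b (by rw [← h]; abel)) hab
  by_cases hbc : b = c
  · subst hbc
    exact absurd (key b a (by rw [← h]; abel)).symm hab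
  exact absurd h (hS a ha b hb c hc hab hac hbc)

theorem sliceMul_eq_iff {ℓ : Dual (ZMod 3) (Fin n → ZMod 3)} {x y z : ℕ} :
    sliceMul S ℓ = {x, y, z} ↔ isPerm x y z (profile S ℓ) = true :=
  (isPerm_iff (a := profile S ℓ)).symm

theorem nineMul_eq_sum (ℓ m : Dual (ZMod 3) (Fin n → ZMod 3)) {i j k : ZMod 3} (hij : i ≠ j)
    (hik : i ≠ k) (hjk : j ≠ k) : nineMul S ℓ m =
      sliceMul (slice S ℓ i) m + sliceMul (slice S ℓ j) m + sliceMul (slice S ℓ k) m := by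
  rw [← sum_zmod_distinct (fun x => sliceMul (slice S ℓ x) m) hij hik hjk]
  simp only [sliceMul, slice, filter_filter]
  change Multiset.map _ (univ.val.bind fun x => univ.val.map (Prod.mk x)) = Multiset.bind univ.val _
  rw [Multiset.map_bind]
  exact congrArg _ (funext fun x => Multiset.map_map _ _ _)

theorem sliceCard_slice_mem_nineMul (ℓ m : Dual (ZMod 3) (Fin n → ZMod 3)) (x y : ZMod 3) :
    sliceCard (slice S ℓ x) m y ∈ nineMul S ℓ m := by
  refine Multiset.mem_map.2 ⟨(x, y), mem_univ_val _, ?_⟩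
  rw [sliceCard, slice, slice, filter_filter]

end Multisets

end CapSlices

/-- A 4-flat direction of the 112-cap 6-flat yields the nine-slice multiset
{18,18,18,18,9,9,9,9,4} iff it is spanned by two independent functionals each with
slice multiset {45,45,22}. -/
theorem cap112_case_i_iff_two_454522 (S : Finset (Fin 6 → ZMod 3)) (hS : IsCap S)
    (hcard : S.card = 112)
    (W : Submodule (ZMod 3) (Module.Dual (ZMod 3) (Fin 6 → ZMod 3)))
    (hW : Module.finrank (ZMod 3) W = 2) :
    (∃ ℓ₁ ℓ₂ : Module.Dual (ZMod 3) (Fin 6 → ZMod 3),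
      LinearIndependent (ZMod 3) ![ℓ₁, ℓ₂] ∧ W = Submodule.span (ZMod 3) {ℓ₁, ℓ₂} ∧
      nineMul S ℓ₁ ℓ₂ = {18, 18, 18, 18, 9, 9, 9, 9, 4}) ↔
    (∃ y₁ y₂ : Module.Dual (ZMod 3) (Fin 6 → ZMod 3),
      LinearIndependent (ZMod 3) ![y₁, y₂] ∧ W = Submodule.span (ZMod 3) {y₁, y₂} ∧
      sliceMul S y₁ = {45, 45, 22} ∧ sliceMul S y₂ = {45, 45, 22}) := by
  have hV : Module.finrank (ZMod 3) (Fin 6 → ZMod 3) = 6 := by simp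
  have hfree := CapSlices.lineFree_of_isCap hS
  constructor
  · rintro ⟨ℓ₁, ℓ₂, hlin, rfl, hnine⟩
    obtain ⟨u, v, huv, hspan, hu, hcells⟩ :=
      CapSlices.exists_extremal_of_cells hV hfree hcard hlin fun x y => by
        have := CapSlices.sliceCard_slice_mem_nineMul (S := S) ℓ₁ ℓ₂ x y
        rw [hnine] at this
        simp at this ⊢
        tauto
    obtain ⟨s, hs⟩ := CapSlices.exists_extremal_add_smul hV hfree huv hu hcells
    refine ⟨u, v + s • u, ?_, ?_, CapSlices.sliceMul_eq_iff.2 hu, CapSlices.sliceMul_eq_iff.2 hs⟩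
    · rw [add_comm]
      exact (LinearIndependent.pair_add_smul_right_iff s).2 huv
    · rw [CapSlices.span_pair_add_smul, hspan]
  · rintro ⟨y₁, y₂, hlin, rfl, h₁, h₂⟩
    obtain ⟨i, j, k, hij, hik, hjk, hA, hB, hC⟩ := CapSlices.isPerm_of_extremal hV hfree hlin
      (CapSlices.sliceMul_eq_iff.1 h₁) (CapSlices.sliceMul_eq_iff.1 h₂)
    refine ⟨y₁, y₂, hlin, rfl, ?_⟩
    rw [CapSlices.nineMul_eq_sum y₁ y₂ hij hik hjk, CapSlices.sliceMul_eq_iff.2 hA,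
      CapSlices.sliceMul_eq_iff.2 hB, CapSlices.sliceMul_eq_iff.2 hC]
    decide
end

section
/- Every cap of size 110 in F = (Fin 6 → ZMod 3) admits a nonzero linear functional ℓ : F → ZMod 3 whose slice multiset is one of the following: {45, 45, 20}, {45, 44, 21}, {45, 43, 22}, {44, 44, 22}, {45, 42, 23}, {44, 43, 23}, or {43, 43, 24}. -/
section Caps

open Module Finset

section Moments

variable {V : Type} [AddCommGroup V]

/-- A cap in an arbitrary vector space over the field of three elements. -/
def CapSet (S : Finset V) : Prop :=
  ∀ a ∈ S, ∀ b ∈ S, ∀ c ∈ S, a ≠ b → a ≠ c → b ≠ c → a + b + c ≠ 0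

theorem CapSet.mono {S T : Finset V} (hS : CapSet S) (h : T ⊆ S) : CapSet T :=
  fun a ha b hb c hc => hS a (h ha) b (h hb) c (h hc)

variable [Module (ZMod 3) V]

/-- The number of points of `S` on which the functional `m` takes the value `i`. -/
def level (S : Finset V) (m : Dual (ZMod 3) V) (i : ZMod 3) : ℕ :=
  (S.filter fun x => m x = i).card

/-- The three level sizes of `m` on `S`. -/
def profile (S : Finset V) (m : Dual (ZMod 3) V) : ℕ × ℕ × ℕ :=
  (level S m 0, level S m 1, level S m 2)

/-- The sum of the squares of the entries of a profile. -/
def energy (a : ℕ × ℕ × ℕ) : ℕ := a.1 * a.1 + a.2.1 * a.2.1 + a.2.2 * a.2.2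

/-- The number of triples with index sum zero, one entry from each of three profiles. -/
def correlation (a b c : ℕ × ℕ × ℕ) : ℕ :=
  a.1 * (b.1 * c.1 + b.2.1 * c.2.2 + b.2.2 * c.2.1) +
  a.2.1 * (b.1 * c.2.2 + b.2.1 * c.2.1 + b.2.2 * c.1) +
  a.2.2 * (b.1 * c.2.1 + b.2.1 * c.1 + b.2.2 * c.2.2)

theorem three_nsmul_eq_zero (x : V) : x + x + x = 0 := by
  have h : (3 : ZMod 3) • x = 0 := by
    rw [show (3 : ZMod 3) = 0 from rfl, zero_smul]
  rw [← h, show (3 : ZMod 3) = 1 + 1 + 1 from rfl, add_smul, add_smul, one_smul]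

theorem CapSet.add_eq_zero_iff {S : Finset V} (hS : CapSet S) {a b c : V} (ha : a ∈ S)
    (hb : b ∈ S) (hc : c ∈ S) : a + b + c = 0 ↔ b = a ∧ c = a := by
  have key : ∀ x y : V, x + x + y = 0 → y = x := fun x y h => by
    have := three_nsmul_eq_zero x
    exact add_left_cancel (h.trans this.symm)
  constructor
  · intro h
    by_cases hab : a = b
    · subst hab
      exact ⟨rfl, key _ _ h⟩
    by_cases hac : a = c
    · subst hac
      have := key a b (by rw [← h]; abel)
      exact absurd this.symm hab
    by_cases hbc : b = c
    · subst hbc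
      exact absurd (key b a (by rw [← h]; abel)) hab
    exact absurd h (hS a ha b hb c hc hab hac hbc)
  · rintro ⟨rfl, rfl⟩
    exact three_nsmul_eq_zero _

theorem sum_comp_level (S : Finset V) (m : Dual (ZMod 3) V) (f : ZMod 3 → ℕ) :
    ∑ x ∈ S, f (m x) = level S m 0 * f 0 + level S m 1 * f 1 + level S m 2 * f 2 := by
  have h : ∑ i : ZMod 3, ∑ x ∈ S with m x = i, f (m x) = ∑ x ∈ S, f (m x) :=
    sum_fiberwise S m fun x => f (m x)
  have h' : ∀ i : ZMod 3, ∑ x ∈ S with m x = i, f (m x) = level S m i * f i := fun i => by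
    rw [sum_congr rfl fun x hx => by rw [(mem_filter.1 hx).2], sum_const, smul_eq_mul, level]
  rw [← h, sum_congr rfl fun i _ => h' i]
  exact Fin.sum_univ_three _

theorem level_add (S : Finset V) (m : Dual (ZMod 3) V) :
    level S m 0 + level S m 1 + level S m 2 = S.card := by
  have := sum_comp_level S m fun _ => 1
  simpa using this.symm

theorem energy_profile (S : Finset V) (m : Dual (ZMod 3) V) :
    energy (profile S m) = ∑ a ∈ S, ∑ b ∈ S, if m (a - b) = 0 then 1 else 0 := by
  simp only [map_sub]
  rw [sum_congr rfl fun a _ => sum_comp_level S m fun j => if m a - j = 0 then 1 else 0,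
    sum_comp_level S m fun i => level S m 0 * (if i - 0 = 0 then 1 else 0) +
      level S m 1 * (if i - 1 = 0 then 1 else 0) + level S m 2 * (if i - 2 = 0 then 1 else 0)]
  simp +decide [energy, profile]

theorem correlation_profile (A B C : Finset V) (m : Dual (ZMod 3) V) :
    correlation (profile A m) (profile B m) (profile C m) =
      ∑ a ∈ A, ∑ b ∈ B, ∑ c ∈ C, if m (a + b + c) = 0 then 1 else 0 := by
  have key : ∀ g : ZMod 3 → ZMod 3 → ℕ, ∑ a ∈ A, ∑ b ∈ B, g (m a) (m b) =
      level A m 0 * (level B m 0 * g 0 0 + level B m 1 * g 0 1 + level B m 2 * g 0 2) +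
      level A m 1 * (level B m 0 * g 1 0 + level B m 1 * g 1 1 + level B m 2 * g 1 2) +
      level A m 2 * (level B m 0 * g 2 0 + level B m 1 * g 2 1 + level B m 2 * g 2 2) := fun g => by
    rw [sum_congr rfl fun a _ => sum_comp_level B m (g (m a)),
      sum_comp_level A m fun i => level B m 0 * g i 0 + level B m 1 * g i 1 + level B m 2 * g i 2]
  simp only [map_add]
  rw [sum_congr rfl fun a _ => sum_congr rfl fun b _ =>
    sum_comp_level C m fun k => if m a + m b + k = 0 then 1 else 0,
    key fun i j => level C m 0 * (if i + j + 0 = 0 then 1 else 0) +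
      level C m 1 * (if i + j + 1 = 0 then 1 else 0) +
      level C m 2 * (if i + j + 2 = 0 then 1 else 0)]
  simp +decide [correlation, profile]

variable [Fintype (Dual (ZMod 3) V)]

theorem card_dual {d : ℕ} (hd : finrank (ZMod 3) V = d) :
    Fintype.card (Dual (ZMod 3) V) = 3 ^ d := by
  rw [Module.card_eq_pow_finrank (K := ZMod 3), Subspace.dual_finrank_eq, hd, ZMod.card]

theorem card_annihilating [Finite V] [DecidableEq V] {d : ℕ} (hd : finrank (ZMod 3) V = d + 1) (v : V) :
    (∑ m : Dual (ZMod 3) V, if m v = 0 then 1 else 0) = 3 ^ d * (1 + if v = 0 then 2 else 0) := by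
  by_cases hv : v = 0
  · simp [hv, card_dual hd, pow_succ]
  · have h := Subspace.finrank_add_finrank_dualAnnihilator_eq (K := ZMod 3)
      (Submodule.span (ZMod 3) {v})
    rw [finrank_span_singleton hv, hd] at h
    have h2 := Module.natCard_eq_pow_finrank (K := ZMod 3)
      (V := (Submodule.span (ZMod 3) {v}).dualAnnihilator)
    rw [show finrank (ZMod 3) (Submodule.span (ZMod 3) {v}).dualAnnihilator = d by omega,
      Nat.card_zmod] at h2
    rw [if_neg hv, add_zero, mul_one, ← h2, Finset.sum_boole, Nat.cast_id,
      ← Nat.subtype_card (univ.filter fun m : Dual (ZMod 3) V => m v = 0)]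
    intro m
    simp only [mem_filter, mem_univ, true_and, Submodule.mem_dualAnnihilator,
      Submodule.mem_span_singleton]
    constructor
    · rintro h _ ⟨c, rfl⟩
      simp [h]
    · exact fun h => h v ⟨1, one_smul _ v⟩

theorem sum_energy [Finite V] {d : ℕ} (hd : finrank (ZMod 3) V = d + 1) (S : Finset V) :
    ∑ m : Dual (ZMod 3) V, energy (profile S m) = 3 ^ d * (S.card * S.card + 2 * S.card) := by
  classical
  simp only [energy_profile]
  rw [sum_comm, sum_congr rfl fun a _ => sum_comm]
  simp only [card_annihilating hd, sub_eq_zero, ← mul_sum]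
  congr 1
  have h : ∀ a ∈ S, ∑ b ∈ S, (1 + if a = b then 2 else 0) = S.card + 2 := fun a ha => by
    rw [sum_add_distrib]
    simp [ha]
  rw [sum_congr rfl h, sum_const, smul_eq_mul]
  ring

theorem sum_correlation [Finite V] {d : ℕ} (hd : finrank (ZMod 3) V = d + 1) (A B C : Finset V)
    (h : ∀ a ∈ A, ∀ b ∈ B, ∀ c ∈ C, a + b + c ≠ 0) :
    ∑ m : Dual (ZMod 3) V, correlation (profile A m) (profile B m) (profile C m) =
      3 ^ d * (A.card * B.card * C.card) := by
  classical
  simp only [correlation_profile]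
  rw [sum_comm, sum_congr rfl fun a _ => (sum_comm.trans (sum_congr rfl fun b _ => sum_comm))]
  simp only [card_annihilating hd, ← mul_sum]
  congr 1
  rw [sum_congr rfl fun a ha => sum_congr rfl fun b hb => sum_congr rfl fun c hc => by
    rw [if_neg (h a ha b hb c hc), add_zero]]
  simp
  ring

theorem CapSet.sum_correlation [Finite V] {d : ℕ} (hd : finrank (ZMod 3) V = d + 1) {S : Finset V}
    (hS : CapSet S) :
    ∑ m : Dual (ZMod 3) V, correlation (profile S m) (profile S m) (profile S m) =
      3 ^ d * (S.card * S.card * S.card + 2 * S.card) := by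
  classical
  simp only [correlation_profile]
  rw [sum_comm, sum_congr rfl fun a _ => (sum_comm.trans (sum_congr rfl fun b _ => sum_comm))]
  simp only [card_annihilating hd, ← mul_sum]
  congr 1
  have h : ∀ a ∈ S, ∑ b ∈ S, ∑ c ∈ S, (1 + if a + b + c = 0 then 2 else 0) =
      S.card * S.card + 2 := fun a ha => by
    rw [sum_congr rfl fun b hb => sum_congr rfl fun c hc => by
      rw [if_congr (hS.add_eq_zero_iff ha hb hc) rfl rfl]]
    simp only [sum_add_distrib, ite_and]
    simp [ha]
  rw [sum_congr rfl h, sum_const, smul_eq_mul]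
  ring

end Moments

section Slices

variable {V : Type} [AddCommGroup V] [Module (ZMod 3) V]

theorem CapSet.exists_translate {S : Finset V} (hS : CapSet S) (l : Dual (ZMod 3) V) (v : V) :
    ∃ T : Finset (LinearMap.ker l), CapSet T ∧
      ∀ m : Dual (ZMod 3) V, m v = 0 → ∀ j,
        level T (m.domRestrict (LinearMap.ker l)) j = level (S.filter fun x => l x = l v) m j := by
  classical
  have hinj : Function.Injective fun x : LinearMap.ker l => (x : V) + v :=
    fun x y h => Subtype.ext (add_right_cancel h)
  refine ⟨S.preimage (fun x => (x : V) + v) hinj.injOn, ?_, ?_⟩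
  · intro a ha b hb c hc hab hac hbc h
    rw [mem_preimage] at ha hb hc
    refine hS _ ha _ hb _ hc (hinj.ne hab) (hinj.ne hac) (hinj.ne hbc) ?_
    have h' := congrArg (Subtype.val) h
    simp only [Submodule.coe_add, Submodule.coe_zero] at h'
    calc (a : V) + v + (b + v) + (c + v) = (a + b + c) + (v + v + v) := by abel
      _ = 0 := by rw [h', three_nsmul_eq_zero, add_zero]
  · intro m hm j
    unfold level
    rw [← card_image_of_injective _ hinj]
    congr 1
    ext x
    simp only [mem_image, mem_filter, mem_preimage]
    simp only [LinearMap.domRestrict_apply]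
    constructor
    · rintro ⟨y, ⟨hy, hj⟩, rfl⟩
      have := y.2
      rw [LinearMap.mem_ker] at this
      refine ⟨⟨hy, ?_⟩, ?_⟩ <;> simp [this, hj, hm]
    · rintro ⟨⟨hx, hl⟩, hj⟩
      refine ⟨⟨x - v, ?_⟩, ⟨?_, ?_⟩, ?_⟩
      · simp [hl]
      · simpa using hx
      · simp [hj, hm]
      · simp

theorem finrank_ker_of_ne_zero [Finite V] {d : ℕ} (hd : finrank (ZMod 3) V = d + 1)
    {l : Dual (ZMod 3) V} (hl : l ≠ 0) : finrank (ZMod 3) (LinearMap.ker l) = d := by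
  have := Module.Dual.finrank_ker_add_one_of_ne_zero hl
  omega

theorem exists_apply_eq_apply_eq_zero {l m : Dual (ZMod 3) V} (hl : l ≠ 0)
    (hm : ∀ t : ZMod 3, m ≠ t • l) (w : ZMod 3) :
    m.domRestrict (LinearMap.ker l) ≠ 0 ∧ ∃ v, l v = w ∧ m v = 0 := by
  obtain ⟨u, hu⟩ := LinearMap.surjective hl 1
  have hres : m.domRestrict (LinearMap.ker l) ≠ 0 := by
    intro h
    refine hm (m u) (LinearMap.ext fun x => ?_)
    have hx : x - l x • u ∈ LinearMap.ker l := by simp [hu]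
    have := LinearMap.congr_fun h ⟨_, hx⟩
    simp only [LinearMap.domRestrict_apply, map_sub, map_smul, LinearMap.zero_apply,
      sub_eq_zero] at this
    rw [this]
    simp [mul_comm]
  refine ⟨hres, ?_⟩
  obtain ⟨y, hy⟩ := LinearMap.surjective hres (m (w • u))
  refine ⟨w • u - y, ?_, ?_⟩
  · have := y.2
    rw [LinearMap.mem_ker] at this
    simp [hu, this]
  · rw [LinearMap.domRestrict_apply] at hy
    rw [map_sub, hy, sub_self]

/-- Every cap in a space of dimension `d` has at most `N` points. -/
def CapBound (d N : ℕ) : Prop :=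
  ∀ (V : Type) [AddCommGroup V] [Module (ZMod 3) V] [Finite V], finrank (ZMod 3) V = d →
    ∀ S : Finset V, CapSet S → S.card ≤ N

/-- The level sizes of every nonzero functional on every cap in dimension `d` satisfy `R`,
in any order. -/
def ProfileBound (d : ℕ) (R : ℕ → ℕ → ℕ → Bool) : Prop :=
  ∀ (V : Type) [AddCommGroup V] [Module (ZMod 3) V] [Finite V], finrank (ZMod 3) V = d →
    ∀ S : Finset V, CapSet S → ∀ m : Dual (ZMod 3) V, m ≠ 0 →
      ∀ i j k : ZMod 3, i ≠ j → i ≠ k → j ≠ k → R (level S m i) (level S m j) (level S m k) = true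

theorem CapBound.of_card_ne {d N : ℕ}
    (h : ∀ (V : Type) [AddCommGroup V] [Module (ZMod 3) V] [Finite V], finrank (ZMod 3) V = d →
      ∀ S : Finset V, CapSet S → S.card ≠ N + 1) : CapBound d N := by
  intro V _ _ _ hd S hS
  by_contra hlt
  obtain ⟨T, hTS, hT⟩ := exists_subset_card_eq (show N + 1 ≤ S.card by omega)
  exact h V hd T (hS.mono hTS) hT

variable [Finite V] {d : ℕ}

theorem CapBound.level_le {N : ℕ} (hN : CapBound d N) (hd : finrank (ZMod 3) V = d + 1)
    {S : Finset V} (hS : CapSet S) {l : Dual (ZMod 3) V} (hl : l ≠ 0) (i : ZMod 3) :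
    level S l i ≤ N := by
  obtain ⟨v, rfl⟩ := LinearMap.surjective hl i
  obtain ⟨T, hT, h⟩ := hS.exists_translate l v
  have h0 := h 0 rfl 0
  have h1 := hN _ (finrank_ker_of_ne_zero hd hl) T hT
  simp only [level, LinearMap.domRestrict_apply, LinearMap.zero_apply, filter_true] at h0 ⊢
  omega

theorem ProfileBound.filter_level {R : ℕ → ℕ → ℕ → Bool} (hR : ProfileBound d R)
    (hd : finrank (ZMod 3) V = d + 1) {S : Finset V} (hS : CapSet S) {l m : Dual (ZMod 3) V}
    (hl : l ≠ 0) (hm : ∀ t : ZMod 3, m ≠ t • l) (w : ZMod 3) {i j k : ZMod 3} (hij : i ≠ j)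
    (hik : i ≠ k) (hjk : j ≠ k) :
    R (level (S.filter fun x => l x = w) m i) (level (S.filter fun x => l x = w) m j)
      (level (S.filter fun x => l x = w) m k) = true := by
  obtain ⟨hres, v, rfl, hmv⟩ := exists_apply_eq_apply_eq_zero hl hm w
  obtain ⟨T, hT, h⟩ := hS.exists_translate l v
  simp only [← h m hmv]
  exact hR _ (finrank_ker_of_ne_zero hd hl) T hT _ hres i j k hij hik hjk

theorem ProfileBound.transversal {R : ℕ → ℕ → ℕ → Bool} (hR : ProfileBound d R)
    (hd : finrank (ZMod 3) V = d + 1) {S : Finset V} (hS : CapSet S) {l m : Dual (ZMod 3) V}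
    (hl : l ≠ 0) (hm : ∀ t : ZMod 3, m ≠ t • l) {i j k p q r : ZMod 3} (hij : i ≠ j)
    (hik : i ≠ k) (hjk : j ≠ k) (hpqr : p + q + r = 0) :
    R (level (S.filter fun x => l x = i) m p) (level (S.filter fun x => l x = j) m q)
      (level (S.filter fun x => l x = k) m r) = true := by
  obtain ⟨t, w, hp, hq, hr⟩ : ∃ t w : ZMod 3, p = w - t * i ∧ q = w - t * j ∧ r = w - t * k := by
    revert i j k p q r
    decide
  have hn : m + t • l ≠ 0 := fun h => hm (-t) (LinearMap.ext fun x => by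
    have hx := LinearMap.congr_fun h x
    simp only [LinearMap.add_apply, LinearMap.smul_apply, smul_eq_mul, LinearMap.zero_apply] at hx ⊢
    linear_combination hx)
  have hs : ∀ s : ZMod 3, l ≠ s • (m + t • l) := by
    intro s h
    by_cases h0 : s = 0
    · exact hl (by rw [h, h0, zero_smul])
    · refine hm (s⁻¹ - t) (LinearMap.ext fun x => ?_)
      have hx := LinearMap.congr_fun h x
      simp only [LinearMap.add_apply, LinearMap.smul_apply, smul_eq_mul] at hx ⊢
      linear_combination (-s⁻¹) * hx - (m x + t * l x) * inv_mul_cancel₀ h0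
  have := hR.filter_level hd hS hn hs w hij hik hjk
  have key : ∀ x y : ZMod 3, y = w - t * x →
      level (S.filter fun z => (m + t • l) z = w) l x = level (S.filter fun z => l z = x) m y := by
    rintro x _ rfl
    unfold level
    congr 1
    ext z
    simp only [mem_filter, LinearMap.add_apply, LinearMap.smul_apply, smul_eq_mul]
    constructor
    · rintro ⟨⟨hz, h1⟩, rfl⟩
      exact ⟨⟨hz, rfl⟩, eq_sub_of_add_eq h1⟩
    · rintro ⟨⟨hz, rfl⟩, h1⟩
      exact ⟨⟨hz, by rw [h1, sub_add_cancel]⟩, rfl⟩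
  rwa [key i p hp, key j q hq, key k r hr] at this

end Slices

section Tests

variable {V : Type} [AddCommGroup V] [Module (ZMod 3) V]

theorem energy_eq_of_const {A : Finset V} {m : Dual (ZMod 3) V} {i : ZMod 3}
    (h : ∀ a ∈ A, m a = i) : energy (profile A m) = A.card * A.card := by
  rw [energy_profile, sum_congr rfl fun a ha => sum_congr rfl fun b hb => by
    rw [map_sub, h a ha, h b hb, sub_self, if_pos rfl]]
  simp

theorem correlation_eq_of_const {A B C : Finset V} {m : Dual (ZMod 3) V} {i j k : ZMod 3}
    (hA : ∀ a ∈ A, m a = i) (hB : ∀ b ∈ B, m b = j) (hC : ∀ c ∈ C, m c = k)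
    (h : i + j + k = 0) :
    correlation (profile A m) (profile B m) (profile C m) = A.card * B.card * C.card := by
  rw [correlation_profile, sum_congr rfl fun a ha => sum_congr rfl fun b hb =>
    sum_congr rfl fun c hc => by
      rw [map_add, map_add, hA a ha, hB b hb, hC c hc, h, if_pos rfl]]
  simp [mul_assoc]

theorem apply_perm_eq {α : Type} (g : ℕ → ℕ → ℕ → α) (h₁ : ∀ a b c, g b a c = g a b c)
    (h₂ : ∀ a b c, g a c b = g a b c) (f : ZMod 3 → ℕ) {i j k : ZMod 3} (hij : i ≠ j)
    (hik : i ≠ k) (hjk : j ≠ k) : g (f i) (f j) (f k) = g (f 0) (f 1) (f 2) := by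
  have hc : ∀ a b c, g b c a = g a b c := fun a b c => (h₂ _ _ _).trans (h₁ _ _ _)
  have hi : i = 0 ∨ i = 1 ∨ i = 2 := by
    clear hij hik
    decide +revert
  have hjk' : (j = i + 1 ∧ k = i + 2) ∨ (j = i + 2 ∧ k = i + 1) := by
    clear f hi
    decide +revert
  rcases hjk' with ⟨rfl, rfl⟩ | ⟨rfl, rfl⟩
  · rcases hi with rfl | rfl | rfl
    · rfl
    · exact hc _ _ _
    · exact (hc _ _ _).trans (hc _ _ _)
  · rcases hi with rfl | rfl | rfl
    · exact h₂ _ _ _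
    · exact h₁ _ _ _
    · exact (h₂ _ _ _).trans ((hc _ _ _).trans (hc _ _ _))

theorem energy_eq (S : Finset V) (m : Dual (ZMod 3) V) {i j k : ZMod 3} (hij : i ≠ j)
    (hik : i ≠ k) (hjk : j ≠ k) :
    energy (profile S m) = energy (level S m i, level S m j, level S m k) :=
  (apply_perm_eq (fun a b c => energy (a, b, c)) (fun a b c => by simp only [energy]; ring)
    (fun a b c => by simp only [energy]; ring) (level S m) hij hik hjk).symm

theorem levels_add (S : Finset V) (m : Dual (ZMod 3) V) {i j k : ZMod 3} (hij : i ≠ j)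
    (hik : i ≠ k) (hjk : j ≠ k) : level S m i + level S m j + level S m k = S.card :=
  (apply_perm_eq (fun a b c => a + b + c) (fun a b c => by ring) (fun a b c => by ring)
    (level S m) hij hik hjk).trans (level_add S m)

/-- The triple correlation of a profile with itself. -/
def cubic (a : ℕ × ℕ × ℕ) : ℕ := correlation a a a

theorem cubic_eq (S : Finset V) (m : Dual (ZMod 3) V) {i j k : ZMod 3} (hij : i ≠ j)
    (hik : i ≠ k) (hjk : j ≠ k) :
    cubic (profile S m) = cubic (level S m i, level S m j, level S m k) :=
  (apply_perm_eq (fun a b c => cubic (a, b, c))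
    (fun a b c => by simp only [cubic, correlation]; ring)
    (fun a b c => by simp only [cubic, correlation]; ring) (level S m) hij hik hjk).symm

/-- A combination of the quadratic and cubic moments of a profile. -/
def test (y0 y1 y2 : ℤ) (a : ℕ × ℕ × ℕ) : ℤ := y0 + y1 * energy a + y2 * cubic a

/-- The sum of `test y0 y1 y2` over the nonzero functionals on an `n`-cap in dimension `d + 1`. -/
def testTotal (y0 y1 y2 : ℤ) (d n : ℕ) : ℤ :=
  y0 * (3 * 3 ^ d - 1) + y1 * (3 ^ d * (n * n + 2 * n) - n * n) +
    y2 * (3 ^ d * (n * n * n + 2 * n) - n * n * n)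

/-- A combination of the moments of three profiles, one for each slice of a pencil. -/
def pencilTest (y0 y1 y2 y3 y4 y5 y6 y7 : ℤ) (a b c : ℕ × ℕ × ℕ) : ℤ :=
  y0 + y1 * energy a + y2 * cubic a + y3 * energy b + y4 * cubic b + y5 * energy c +
    y6 * cubic c + y7 * correlation a b c

/-- The sum of `pencilTest` over the functionals outside a line of the dual space. -/
def pencilTotal (y0 y1 y2 y3 y4 y5 y6 y7 : ℤ) (d n₀ n₁ n₂ : ℕ) : ℤ :=
  let e (n : ℕ) : ℤ := 3 ^ d * (n * n + 2 * n) - 3 * (n * n)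
  let f (n : ℕ) : ℤ := 3 ^ d * (n * n * n + 2 * n) - 3 * (n * n * n)
  y0 * (3 * 3 ^ d - 3) + y1 * e n₀ + y2 * f n₀ + y3 * e n₁ + y4 * f n₁ + y5 * e n₂ +
    y6 * f n₂ + y7 * (3 ^ d * (n₀ * n₁ * n₂) - 3 * (n₀ * n₁ * n₂))

theorem cast_sum_eq {α : Type} (s : Finset α) (f : α → ℕ) {n : ℕ} (h : ∑ x ∈ s, f x = n) :
    ∑ x ∈ s, (f x : ℤ) = n := by
  rw [← h, Nat.cast_sum]

theorem sum_filter_not_line [Fintype (Dual (ZMod 3) V)] {l : Dual (ZMod 3) V} (hl : l ≠ 0)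
    [DecidablePred fun m : Dual (ZMod 3) V => ∀ t : ZMod 3, m ≠ t • l]
    (f : Dual (ZMod 3) V → ℤ) (c : ℤ) (hf : ∀ t : ZMod 3, f (t • l) = c) :
    ∑ m with ∀ t : ZMod 3, m ≠ t • l, f m = ∑ m, f m - 3 * c := by
  classical
  have hinj : Function.Injective fun t : ZMod 3 => t • l := smul_left_injective _ hl
  rw [eq_sub_iff_add_eq, ← sum_filter_add_sum_filter_not univ (fun m => ∀ t : ZMod 3, m ≠ t • l) f]
  congr 1
  have : (univ.filter fun m : Dual (ZMod 3) V => ¬ ∀ t : ZMod 3, m ≠ t • l) =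
      univ.image fun t : ZMod 3 => t • l := by
    ext m
    simp [eq_comm]
  rw [this, sum_image fun a _ b _ h => hinj h, sum_congr rfl fun t _ => hf t]
  simp

variable [Finite V] {d : ℕ} {S : Finset V}

theorem finite_dual : Finite (Dual (ZMod 3) V) := Finite.of_injective _ DFunLike.coe_injective

theorem CapSet.sum_test [Fintype (Dual (ZMod 3) V)] [DecidableEq (Dual (ZMod 3) V)]
    (hS : CapSet S) (hd : finrank (ZMod 3) V = d + 1)
    (y0 y1 y2 : ℤ) :
    ∑ m ∈ (univ : Finset (Dual (ZMod 3) V)).erase 0, test y0 y1 y2 (profile S m) =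
      testTotal y0 y1 y2 d S.card := by
  have hc : (∑ _m : Dual (ZMod 3) V, 1) = 3 ^ (d + 1) := by
    rw [sum_const, smul_eq_mul, mul_one, card_univ, card_dual hd]
  have h1 := cast_sum_eq _ _ (sum_energy hd S)
  have h2 := cast_sum_eq _ _ (hS.sum_correlation hd)
  have h0 := cast_sum_eq _ _ hc
  rw [← add_left_inj (test y0 y1 y2 (profile S 0)), sum_erase_add _ _ (mem_univ _)]
  simp only [test, cubic, testTotal, sum_add_distrib, ← mul_sum]
  rw [h1, h2, energy_eq_of_const (i := 0) fun _ _ => rfl,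
    correlation_eq_of_const (i := 0) (j := 0) (k := 0) (fun _ _ => rfl) (fun _ _ => rfl)
      (fun _ _ => rfl) rfl]
  have h0' : ∑ _m : Dual (ZMod 3) V, y0 = y0 * 3 ^ (d + 1) := by
    have := congrArg (y0 * ·) h0
    simpa [mul_sum, mul_comm] using this
  rw [h0']
  push_cast
  ring

theorem CapSet.testTotal_nonneg (hS : CapSet S) (hd : finrank (ZMod 3) V = d + 1)
    (y0 y1 y2 : ℤ) (h : ∀ m : Dual (ZMod 3) V, m ≠ 0 → 0 ≤ test y0 y1 y2 (profile S m)) :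
    0 ≤ testTotal y0 y1 y2 d S.card := by
  classical
  have := finite_dual (V := V)
  have := Fintype.ofFinite (Dual (ZMod 3) V)
  rw [← hS.sum_test hd]
  exact sum_nonneg fun m hm => h m (ne_of_mem_erase hm)

theorem CapSet.test_eq_zero (hS : CapSet S) (hd : finrank (ZMod 3) V = d + 1)
    (y0 y1 y2 : ℤ) (h : ∀ m : Dual (ZMod 3) V, m ≠ 0 → 0 ≤ test y0 y1 y2 (profile S m))
    (h0 : testTotal y0 y1 y2 d S.card = 0) (m : Dual (ZMod 3) V) (hm : m ≠ 0) :
    test y0 y1 y2 (profile S m) = 0 := by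
  classical
  have := finite_dual (V := V)
  have := Fintype.ofFinite (Dual (ZMod 3) V)
  rw [← hS.sum_test hd, sum_eq_zero_iff_of_nonneg fun m hm => h m (ne_of_mem_erase hm)] at h0
  exact h0 m (mem_erase.2 ⟨hm, mem_univ _⟩)

theorem CapSet.pencilTotal_nonneg (hS : CapSet S) (hd : finrank (ZMod 3) V = d + 1)
    {l : Dual (ZMod 3) V} (hl : l ≠ 0) {i j k : ZMod 3} (hij : i ≠ j) (hik : i ≠ k) (hjk : j ≠ k)
    (y0 y1 y2 y3 y4 y5 y6 y7 : ℤ)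
    (h : ∀ m : Dual (ZMod 3) V, (∀ t : ZMod 3, m ≠ t • l) →
      0 ≤ pencilTest y0 y1 y2 y3 y4 y5 y6 y7 (profile (S.filter fun x => l x = i) m)
        (profile (S.filter fun x => l x = j) m) (profile (S.filter fun x => l x = k) m)) :
    0 ≤ pencilTotal y0 y1 y2 y3 y4 y5 y6 y7 d (level S l i) (level S l j) (level S l k) := by
  classical
  have := finite_dual (V := V)
  have := Fintype.ofFinite (Dual (ZMod 3) V)
  have hcap : ∀ w, CapSet (S.filter fun x => l x = w) := fun w => hS.mono (filter_subset _ _)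
  have hconst : ∀ (t w : ZMod 3), ∀ a ∈ S.filter (fun x => l x = w), (t • l) a = t * w :=
    fun t w a ha => by rw [LinearMap.smul_apply, (mem_filter.1 ha).2, smul_eq_mul]
  have hsum3 : i + j + k = 0 := by
    clear h
    decide +revert
  have hABC : ∀ a ∈ S.filter (fun x => l x = i), ∀ b ∈ S.filter (fun x => l x = j),
      ∀ c ∈ S.filter (fun x => l x = k), a + b + c ≠ 0 := by
    intro a ha b hb c hc
    rw [mem_filter] at ha hb hc
    refine hS a ha.1 b hb.1 c hc.1 ?_ ?_ ?_ <;> rintro rfl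
    · exact hij (ha.2.symm.trans hb.2)
    · exact hik (ha.2.symm.trans hc.2)
    · exact hjk (hb.2.symm.trans hc.2)
  have he : ∀ w, ∑ m with ∀ t : ZMod 3, m ≠ t • l,
      (energy (profile (S.filter fun x => l x = w) m) : ℤ) =
      3 ^ d * (level S l w * level S l w + 2 * level S l w) - 3 * (level S l w * level S l w) := by
    intro w
    rw [sum_filter_not_line hl _ (level S l w * level S l w) fun t => by
      rw [energy_eq_of_const (hconst t w)]; exact Nat.cast_mul _ _,
      cast_sum_eq _ _ (sum_energy hd _)]
    push_cast
    rfl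
  have hf : ∀ w, ∑ m with ∀ t : ZMod 3, m ≠ t • l,
      (cubic (profile (S.filter fun x => l x = w) m) : ℤ) =
      3 ^ d * (level S l w * level S l w * level S l w + 2 * level S l w) -
        3 * (level S l w * level S l w * level S l w) := by
    intro w
    unfold cubic
    rw [sum_filter_not_line hl _ (level S l w * level S l w * level S l w) fun t => by
      rw [correlation_eq_of_const (hconst t w) (hconst t w) (hconst t w) (by
        rw [← three_nsmul_eq_zero (t * w)])]
      push_cast
      rfl,
      cast_sum_eq _ _ ((hcap w).sum_correlation hd)]
    push_cast
    rfl
  have hg : ∑ m with ∀ t : ZMod 3, m ≠ t • l,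
      (correlation (profile (S.filter fun x => l x = i) m)
        (profile (S.filter fun x => l x = j) m) (profile (S.filter fun x => l x = k) m) : ℤ) =
      3 ^ d * (level S l i * level S l j * level S l k) -
        3 * (level S l i * level S l j * level S l k) := by
    rw [sum_filter_not_line hl _ (level S l i * level S l j * level S l k) fun t => by
      rw [correlation_eq_of_const (hconst t i) (hconst t j) (hconst t k) (by
        rw [← mul_add, ← mul_add, hsum3, mul_zero])]
      push_cast
      rfl,
      cast_sum_eq _ _ (_root_.sum_correlation hd _ _ _ hABC)]
    push_cast
    rfl
  have h0 : ∑ m : Dual (ZMod 3) V with ∀ t : ZMod 3, m ≠ t • l, y0 = y0 * (3 * 3 ^ d - 3) := by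
    rw [sum_filter_not_line hl _ y0 fun _ => rfl, sum_const, card_univ, card_dual hd]
    simp
    ring
  have key := sum_nonneg fun m (hm : m ∈ univ.filter fun m => ∀ t : ZMod 3, m ≠ t • l) =>
    h m (mem_filter.1 hm).2
  simp only [pencilTest, sum_add_distrib, ← mul_sum, he, hf, hg, h0] at key
  exact key

theorem exists_sorted (f : ZMod 3 → ℕ) :
    ∃ i j k : ZMod 3, i ≠ j ∧ i ≠ k ∧ j ≠ k ∧ f k ≤ f j ∧ f j ≤ f i := by
  rcases le_total (f 0) (f 1) with h1 | h1 <;> rcases le_total (f 0) (f 2) with h2 | h2 <;>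
    rcases le_total (f 1) (f 2) with h3 | h3
  · exact ⟨2, 1, 0, by decide, by decide, by decide, h1, h3⟩
  · exact ⟨1, 2, 0, by decide, by decide, by decide, h2, h3⟩
  · exact ⟨2, 1, 0, by decide, by decide, by decide, h1, h3⟩
  · exact ⟨1, 0, 2, by decide, by decide, by decide, h2, h1⟩
  · exact ⟨2, 0, 1, by decide, by decide, by decide, h1, h2⟩
  · exact ⟨2, 0, 1, by decide, by decide, by decide, h1, h2⟩
  · exact ⟨0, 2, 1, by decide, by decide, by decide, h3, h2⟩
  · exact ⟨0, 1, 2, by decide, by decide, by decide, h3, h1⟩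

end Tests

section Checks

/-- All triples of natural numbers with sum `n`. -/
def triples (n : ℕ) : List (ℕ × ℕ × ℕ) :=
  (List.range (n + 1)).flatMap fun a => (List.range (n - a + 1)).map fun b => (a, b, n - a - b)

theorem mem_triples (a b c : ℕ) : (a, b, c) ∈ triples (a + b + c) := by
  simp only [triples, List.mem_flatMap, List.mem_map, List.mem_range, Prod.mk.injEq]
  exact ⟨a, by omega, b, by omega, rfl, rfl, by omega⟩

/-- The triples with sum `n` satisfying `R`. -/
def allowed (R : ℕ → ℕ → ℕ → Bool) (n : ℕ) : List (ℕ × ℕ × ℕ) :=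
  (triples n).filter fun a => R a.1 a.2.1 a.2.2

/-- The transversals of three profiles, which are themselves profiles of slices, satisfy `R`. -/
def transversalCheck (R : ℕ → ℕ → ℕ → Bool) (a b c : ℕ × ℕ × ℕ) : Bool :=
  R a.1 b.1 c.1 && R a.2.1 b.2.1 c.2.1 && R a.2.2 b.2.2 c.2.2 &&
    R a.1 b.2.1 c.2.2 && R a.1 b.2.2 c.2.1 && R a.2.1 b.1 c.2.2 &&
    R a.2.1 b.2.2 c.1 && R a.2.2 b.1 c.2.1 && R a.2.2 b.2.1 c.1

/-- The functional `G` is nonnegative on all admissible triples of profiles, normalized so that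
the first profile is sorted and the second one starts with its largest entry. -/
def pencilCheck (R : ℕ → ℕ → ℕ → Bool) (n₀ n₁ n₂ : ℕ)
    (G : ℕ × ℕ × ℕ → ℕ × ℕ × ℕ → ℕ × ℕ × ℕ → ℤ) : Bool :=
  (allowed (fun x y z => Nat.ble z y && Nat.ble y x && R x y z) n₀).all fun a =>
    (allowed (fun x y z => Nat.ble y x && Nat.ble z x && R x y z) n₁).all fun b =>
      (allowed R n₂).all fun c => !transversalCheck R a b c || decide (0 ≤ G a b c)

/-- All sorted triples with sum `n` and entries at most `N` satisfy `P`. -/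
def sortedAll (N n : ℕ) (P : ℕ × ℕ × ℕ → Bool) : Bool :=
  (List.range (N + 1)).all fun a => (List.range (a + 1)).all fun b =>
    !(Nat.ble (a + b) n && Nat.ble (n - a - b) b) || P (a, b, n - a - b)

/-- The test functional is nonnegative on all sorted triples outside `K` with sum `n` and
entries at most `N`. -/
def testCheck (y0 y1 y2 : ℤ) (N n : ℕ) (K : List (ℕ × ℕ × ℕ)) : Bool :=
  sortedAll N n fun t => decide (t ∈ K) || decide (0 ≤ test y0 y1 y2 t)

variable {V : Type} [AddCommGroup V] [Module (ZMod 3) V] [Finite V] {d N : ℕ} {S : Finset V}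

/-- No functional on a cap in dimension `d` has level sizes `n₀`, `n₁`, `n₂`. -/
def Excluded (d : ℕ) (t : ℕ × ℕ × ℕ) : Prop :=
  ∀ (V : Type) [AddCommGroup V] [Module (ZMod 3) V] [Finite V], finrank (ZMod 3) V = d →
    ∀ S : Finset V, CapSet S → ∀ m : Dual (ZMod 3) V, m ≠ 0 →
      ∀ i j k : ZMod 3, i ≠ j → i ≠ k → j ≠ k → (level S m i, level S m j, level S m k) ≠ t

theorem correlation_shift (f g h : ZMod 3 → ℕ) (p q : ZMod 3) {s : ZMod 3} (hs : s ≠ 0) :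
    correlation (f p, f (p + s), f (p + s + s)) (g q, g (q + s), g (q + s + s))
      (h (-p - q), h (-p - q + s), h (-p - q + s + s)) =
      correlation (f 0, f 1, f 2) (g 0, g 1, g 2) (h 0, h 1, h 2) := by
  have hcases : ∀ t : ZMod 3, t = 0 ∨ t = 1 ∨ t = 2 := by decide
  have h11 : (1 : ZMod 3) + 1 = 2 := rfl
  have h12 : (1 : ZMod 3) + 2 = 0 := rfl
  have h21 : (2 : ZMod 3) + 1 = 0 := rfl
  have h22 : (2 : ZMod 3) + 2 = 1 := rfl
  have hn1 : -(1 : ZMod 3) = 2 := rfl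
  have hn2 : -(2 : ZMod 3) = 1 := rfl
  rcases hcases s with rfl | rfl | rfl
  · exact absurd rfl hs
  all_goals
    rcases hcases p with rfl | rfl | rfl <;> rcases hcases q with rfl | rfl | rfl <;>
      simp only [correlation, sub_eq_add_neg, h11, h12, h21, h22, hn1, hn2, neg_zero, zero_add,
        add_zero] <;> ring

theorem ProfileBound.excluded {R : ℕ → ℕ → ℕ → Bool} (hR : ProfileBound d R)
    (y0 y1 y2 y3 y4 y5 y6 y7 : ℤ) {n₀ n₁ n₂ : ℕ}
    (hcheck : pencilCheck R n₀ n₁ n₂ (pencilTest y0 y1 y2 y3 y4 y5 y6 y7) = true)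
    (htot : pencilTotal y0 y1 y2 y3 y4 y5 y6 y7 d n₀ n₁ n₂ < 0) :
    Excluded (d + 1) (n₀, n₁, n₂) := by
  intro V _ _ _ hd S hS l hl i j k hij hik hjk h
  simp only [Prod.mk.injEq] at h
  obtain ⟨rfl, rfl, rfl⟩ := h
  refine htot.not_ge (hS.pencilTotal_nonneg hd hl hij hik hjk _ _ _ _ _ _ _ _ fun m hm => ?_)
  obtain ⟨p, p', p'', hp, hp', hp'', h₂, h₁⟩ := exists_sorted (level (S.filter fun x => l x = i) m)
  obtain ⟨s, hs, rfl, rfl⟩ : ∃ s : ZMod 3, s ≠ 0 ∧ p' = p + s ∧ p'' = p + s + s := by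
    clear h₁ h₂
    decide +revert
  obtain ⟨q, hq⟩ := Finite.exists_max (level (S.filter fun x => l x = j) m)
  have hne : ∀ t : ZMod 3, t ≠ t + s ∧ t ≠ t + s + s ∧ t + s ≠ t + s + s := by
    clear h₁ h₂ hp hp' hp''
    decide +revert
  have hall : ∀ (R' : ℕ → ℕ → ℕ → Bool) (w t : ZMod 3),
      (let f := level (S.filter fun x => l x = w) m
      R' (f t) (f (t + s)) (f (t + s + s)) = true →
        (f t, f (t + s), f (t + s + s)) ∈ allowed R' (level S l w)) := by
    intro R' w t f hf
    refine List.mem_filter.2 ⟨?_, hf⟩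
    rw [show level S l w = _ from (levels_add (S.filter fun x => l x = w) m (hne t).1 (hne t).2.1
      (hne t).2.2).symm]
    exact mem_triples _ _ _
  have hfil := fun w t => hR.filter_level hd hS hl hm w (hne t).1 (hne t).2.1 (hne t).2.2
  have htr : ∀ p q r : ZMod 3, p + q + r = 0 → _ := fun p q r h =>
    hR.transversal hd hS hl hm (p := p) (q := q) (r := r) hij hik hjk h
  have key := List.all_eq_true.1 (List.all_eq_true.1 (List.all_eq_true.1 hcheck _
    (hall _ i p (by simp [Nat.ble_eq_true_of_le h₁, Nat.ble_eq_true_of_le h₂, hfil]))) _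
    (hall _ j q (by simp [Nat.ble_eq_true_of_le (hq _), hfil]))) _ (hall _ k (-p - q) (hfil _ _))
  rw [Bool.or_eq_true, Bool.not_eq_true', decide_eq_true_eq] at key
  have hG := key.resolve_left fun hfalse => by
    rw [← Bool.not_eq_true] at hfalse
    have h3 : s + s + s = 0 := three_nsmul_eq_zero s
    refine hfalse ?_
    simp only [transversalCheck, Bool.and_eq_true]
    refine ⟨⟨⟨⟨⟨⟨⟨⟨?_, ?_⟩, ?_⟩, ?_⟩, ?_⟩, ?_⟩, ?_⟩, ?_⟩, ?_⟩ <;> refine htr _ _ _ ?_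
    · ring
    · linear_combination h3
    · linear_combination 2 * h3
    all_goals linear_combination h3
  simp only [pencilTest, correlation_shift _ _ _ p q hs] at hG
  rw [pencilTest, energy_eq _ m (hne p).1 (hne p).2.1 (hne p).2.2,
    cubic_eq _ m (hne p).1 (hne p).2.1 (hne p).2.2,
    energy_eq _ m (hne q).1 (hne q).2.1 (hne q).2.2,
    cubic_eq _ m (hne q).1 (hne q).2.1 (hne q).2.2,
    energy_eq _ m (hne (-p - q)).1 (hne (-p - q)).2.1 (hne (-p - q)).2.2,
    cubic_eq _ m (hne (-p - q)).1 (hne (-p - q)).2.1 (hne (-p - q)).2.2]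
  exact hG

theorem CapSet.exists_levels (hS : CapSet S) (hN : CapBound d N)
    (hd : finrank (ZMod 3) V = d + 1) {m : Dual (ZMod 3) V} (hm : m ≠ 0)
    {P : ℕ × ℕ × ℕ → Bool} (hP : sortedAll N S.card P = true) :
    ∃ t, P t = true ∧ energy (profile S m) = energy t ∧ cubic (profile S m) = cubic t ∧
      ∃ i j k : ZMod 3, i ≠ j ∧ i ≠ k ∧ j ≠ k ∧ (level S m i, level S m j, level S m k) = t := by
  obtain ⟨i, j, k, hij, hik, hjk, hkj, hji⟩ := exists_sorted (level S m)
  have hsum := levels_add S m hij hik hjk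
  have hk : S.card - level S m i - level S m j = level S m k := by omega
  refine ⟨_, ?_, energy_eq S m hij hik hjk, cubic_eq S m hij hik hjk, i, j, k, hij, hik, hjk, rfl⟩
  have key := List.all_eq_true.1 (List.all_eq_true.1 hP (level S m i)
    (List.mem_range.2 (Nat.lt_succ_of_le (hN.level_le hd hS hm i)))) (level S m j)
    (List.mem_range.2 (Nat.lt_succ_of_le hji))
  rw [hk, Nat.ble_eq_true_of_le hkj, Nat.ble_eq_true_of_le (by omega)] at key
  simpa using key

theorem CapSet.test_nonneg (hS : CapSet S) (hN : CapBound d N) (hd : finrank (ZMod 3) V = d + 1)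
    {K : List (ℕ × ℕ × ℕ)} {m : Dual (ZMod 3) V} (hm : m ≠ 0)
    (hK : ∀ i j k : ZMod 3, i ≠ j → i ≠ k → j ≠ k →
      (level S m i, level S m j, level S m k) ∉ K)
    {y0 y1 y2 : ℤ} (hcheck : testCheck y0 y1 y2 N S.card K = true) :
    0 ≤ test y0 y1 y2 (profile S m) := by
  obtain ⟨t, ht, he, hf, i, j, k, hij, hik, hjk, rfl⟩ := hS.exists_levels hN hd hm hcheck
  rw [test, he, hf, ← test]
  simpa [hK i j k hij hik hjk] using ht

theorem not_mem_of_excluded (hd : finrank (ZMod 3) V = d) (hS : CapSet S)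
    {K : List (ℕ × ℕ × ℕ)} (hK : ∀ t ∈ K, Excluded d t) {m : Dual (ZMod 3) V} (hm : m ≠ 0)
    (i j k : ZMod 3) (hij : i ≠ j) (hik : i ≠ k) (hjk : j ≠ k) :
    (level S m i, level S m j, level S m k) ∉ K :=
  fun h => hK _ h V hd S hS m hm i j k hij hik hjk rfl

theorem CapBound.succ (hN : CapBound d N) {K : List (ℕ × ℕ × ℕ)}
    (hK : ∀ t ∈ K, Excluded (d + 1) t) {M : ℕ} (y0 y1 y2 : ℤ)
    (hcheck : testCheck y0 y1 y2 N (M + 1) K = true) (htot : testTotal y0 y1 y2 d (M + 1) < 0) :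
    CapBound (d + 1) M := by
  refine CapBound.of_card_ne fun V _ _ _ hd S hS h => ?_
  rw [← h] at hcheck htot
  exact htot.not_ge (hS.testTotal_nonneg hd _ _ _ fun m hm =>
    hS.test_nonneg hN hd hm (not_mem_of_excluded hd hS hK hm) hcheck)

end Checks

section LowDimensions

theorem capBound_zero : CapBound 0 1 := by
  intro V _ _ _ hd S _
  have := Module.finrank_zero_iff.1 hd
  exact card_le_one_of_subsingleton S

theorem capBound_one : CapBound 1 2 :=
  capBound_zero.succ (K := []) (by simp) (-9) 0 1 (by decide +kernel) (by decide +kernel)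

theorem capBound_two : CapBound 2 4 :=
  capBound_one.succ (K := []) (by simp) (-41) 0 1 (by decide +kernel) (by decide +kernel)

theorem capBound_three : CapBound 3 9 :=
  capBound_two.succ (K := []) (by simp) (-400) 2 1 (by decide +kernel) (by decide +kernel)

/-- The admissible level sizes of caps in dimension three. -/
def allowedThree (a b c : ℕ) : Bool :=
  a ≤ 4 && b ≤ 4 && c ≤ 4 && a + b + c ≤ 9 && (a + b + c != 9 || energy (a, b, c) != 29)

theorem profileBound_three : ProfileBound 3 allowedThree := by
  intro V _ _ _ hd S hS m hm i j k hij hik hjk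
  have hsum := levels_add S m hij hik hjk
  have hcard := capBound_three V hd S hS
  have hle := capBound_two.level_le hd hS hm
  simp only [allowedThree, ← energy_eq S m hij hik hjk, hsum, Bool.and_eq_true, Bool.or_eq_true,
    decide_eq_true_eq, bne_iff_ne]
  refine ⟨⟨⟨⟨hle i, hle j⟩, hle k⟩, hcard⟩, or_iff_not_imp_left.2 fun h => ?_⟩
  rw [not_not] at h
  have h0 := hS.test_eq_zero hd (-324) 3 1 (fun m hm => hS.test_nonneg capBound_two hd (K := []) hm
    (by simp) (by rw [h]; decide +kernel)) (by rw [h]; decide +kernel) m hm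
  obtain ⟨t, ht, he, hf, -⟩ := hS.exists_levels capBound_two hd hm
    (P := fun t => decide (test (-324) 3 1 t ≠ 0) || energy t != 29) (by rw [h]; decide +kernel)
  rw [test, he, hf, ← test] at h0
  rw [he]
  simpa [h0] using ht

theorem capBound_four : CapBound 4 20 := by
  refine capBound_three.succ (K := [(9, 9, 3)]) ?_ (-3033) 0 1 (by decide +kernel)
    (by decide +kernel)
  simp only [List.forall_mem_cons, List.not_mem_nil, false_imp_iff, implies_true, and_true]
  exact profileBound_three.excluded (-72) 0 0 0 0 (-1) 0 1 (by decide +kernel) (by decide +kernel)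

/-- The admissible level sizes of caps in dimension four. -/
def allowedFour (a b c : ℕ) : Bool :=
  a ≤ 9 && b ≤ 9 && c ≤ 9 && a + b + c ≤ 20 &&
    (a + b + c != 20 || energy (a, b, c) == 166 || energy (a, b, c) == 136) &&
    (a + b + c != 19 || (energy (a, b, c) != 139 && energy (a, b, c) != 133 &&
      energy (a, b, c) != 131))

theorem excluded_of_card_twenty : ∀ t ∈ [(9, 8, 3), (9, 7, 4), (8, 8, 4), (9, 6, 5), (8, 7, 5)],
    Excluded 4 t := by
  simp only [List.forall_mem_cons, List.not_mem_nil, false_imp_iff, implies_true, and_true]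
  refine ⟨profileBound_three.excluded 23 (-2) (-1) (-5) (-1) 22 (-8) 8 ?_ ?_,
    profileBound_three.excluded (-64) 0 0 0 0 (-2) 0 1 ?_ ?_,
    profileBound_three.excluded (-2894) 18 3 6 1 24 5 17 ?_ ?_,
    profileBound_three.excluded (-209) (-3) 0 2 1 (-1) 1 2 ?_ ?_,
    profileBound_three.excluded (-135) (-2) 1 0 0 (-2) 1 0 ?_ ?_⟩ <;> decide +kernel

theorem excluded_of_card_nineteen : ∀ t ∈ [(9, 7, 3), (9, 6, 4), (9, 5, 5)],
    Excluded 4 t := by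
  simp only [List.forall_mem_cons, List.not_mem_nil, false_imp_iff, implies_true, and_true]
  refine ⟨profileBound_three.excluded (-61) (-2) (-1) 3 1 4 (-1) 3 ?_ ?_,
    profileBound_three.excluded (-135) (-2) (-1) 4 1 1 1 4 ?_ ?_,
    profileBound_three.excluded (-49) (-5) (-1) (-2) 3 1 1 4 ?_ ?_⟩ <;> decide +kernel

theorem profileBound_four : ProfileBound 4 allowedFour := by
  intro V _ _ _ hd S hS m hm i j k hij hik hjk
  have hsum := levels_add S m hij hik hjk
  have hcard := capBound_four V hd S hS
  have hle := capBound_three.level_le hd hS hm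
  simp only [allowedFour, ← energy_eq S m hij hik hjk, hsum, Bool.and_eq_true, Bool.or_eq_true,
    decide_eq_true_eq, bne_iff_ne, beq_iff_eq, or_assoc]
  refine ⟨⟨⟨⟨⟨hle i, hle j⟩, hle k⟩, hcard⟩, or_iff_not_imp_left.2 fun h => ?_⟩,
    or_iff_not_imp_left.2 fun h => ?_⟩ <;> rw [not_not] at h
  · have h0 := hS.test_eq_zero hd 18664 (-39) (-5) (fun m hm => hS.test_nonneg capBound_three hd hm
      (not_mem_of_excluded hd hS excluded_of_card_twenty hm) (by rw [h]; decide +kernel))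
      (by rw [h]; decide +kernel) m hm
    obtain ⟨t, ht, he, hf, i, j, k, hij, hik, hjk, rfl⟩ := hS.exists_levels capBound_three hd hm
      (P := fun t => decide (t ∈ [(9, 8, 3), (9, 7, 4), (8, 8, 4), (9, 6, 5), (8, 7, 5)]) ||
        decide (test 18664 (-39) (-5) t ≠ 0) || (energy t == 166 || energy t == 136))
      (by rw [h]; decide +kernel)
    have hK := not_mem_of_excluded hd hS excluded_of_card_twenty hm i j k hij hik hjk
    rw [test, he, hf, ← test] at h0
    rw [he]
    simpa only [hK, h0, ne_eq, not_true_eq_false, decide_false, Bool.false_or, Bool.or_eq_true,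
      beq_iff_eq] using ht
  · obtain ⟨t, ht, he, hf, i, j, k, hij, hik, hjk, rfl⟩ := hS.exists_levels capBound_three hd hm
      (P := fun t => decide (t ∈ [(9, 7, 3), (9, 6, 4), (9, 5, 5)]) ||
        (energy t != 139 && energy t != 133 && energy t != 131))
      (by rw [h]; decide +kernel)
    have hK := not_mem_of_excluded hd hS excluded_of_card_nineteen hm i j k hij hik hjk
    rw [he]
    simpa only [hK, decide_false, Bool.false_or, Bool.and_eq_true, bne_iff_ne] using ht

set_option maxHeartbeats 0 in
theorem excluded_of_card_forty_six :
    ∀ t ∈ [(20, 20, 6), (20, 19, 7), (20, 18, 8), (19, 19, 8)], Excluded 5 t := by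
  simp only [List.forall_mem_cons, List.not_mem_nil, false_imp_iff, implies_true, and_true]
  refine ⟨profileBound_four.excluded (-800) 0 0 0 0 1 0 1 ?_ ?_,
    profileBound_four.excluded (-887) 0 0 0 0 1 0 1 ?_ ?_,
    profileBound_four.excluded (-1110) (-5) (-1) 5 0 4 0 4 ?_ ?_,
    profileBound_four.excluded (-8236) 7 1 7 1 2 0 2 ?_ ?_⟩ <;> decide +kernel

theorem capBound_five : CapBound 5 45 :=
  capBound_four.succ excluded_of_card_forty_six (-78292) 19 2 (by decide +kernel)
    (by decide +kernel)

end LowDimensions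

section DimensionSix

theorem sliceMul_eq {n : ℕ} (S : Finset (Fin n → ZMod 3)) (m : Dual (ZMod 3) (Fin n → ZMod 3))
    {i j k : ZMod 3} (hij : i ≠ j) (hik : i ≠ k) (hjk : j ≠ k) :
    sliceMul S m = {level S m i, level S m j, level S m k} := by
  refine Eq.trans ?_ (apply_perm_eq (fun a b c => ({a, b, c} : Multiset ℕ))
    (fun a b c => Multiset.cons_swap b a {c})
    (fun a b c => congrArg (a ::ₘ ·) (Multiset.cons_swap c b 0)) (level S m) hij hik hjk).symm
  rfl

theorem exists_levels_of_card {S : Finset (Fin 6 → ZMod 3)} (hS : CapSet S)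
    (hcard : S.card = 110) :
    ∃ m : Dual (ZMod 3) (Fin 6 → ZMod 3), m ≠ 0 ∧
      ∃ i j k : ZMod 3, i ≠ j ∧ i ≠ k ∧ j ≠ k ∧ (level S m i, level S m j, level S m k) ∈
        [(45, 45, 20), (45, 44, 21), (45, 43, 22), (44, 44, 22), (45, 42, 23), (44, 43, 23),
          (43, 43, 24)] := by
  by_contra! h
  have hd : finrank (ZMod 3) (Fin 6 → ZMod 3) = 5 + 1 := by simp
  have key := hS.testTotal_nonneg hd (-2589432) 92 5 fun m hm =>
    hS.test_nonneg capBound_five hd hm (h m hm) (by rw [hcard]; decide +kernel)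
  rw [hcard] at key
  exact key.not_gt (by decide +kernel)

end DimensionSix

end Caps

/-- Every 110-cap 6-flat has a hyperplane direction with slice multiset among
{45,45,20}, {45,44,21}, {45,43,22}, {44,44,22}, {45,42,23}, {44,43,23}, {43,43,24}. -/
theorem cap110_has_large_direction (S : Finset (Fin 6 → ZMod 3)) (hS : IsCap S)
    (hcard : S.card = 110) :
    ∃ ℓ : (Fin 6 → ZMod 3) →ₗ[ZMod 3] ZMod 3, ℓ ≠ 0 ∧
      (sliceMul S ℓ = {45, 45, 20} ∨ sliceMul S ℓ = {45, 44, 21} ∨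
       sliceMul S ℓ = {45, 43, 22} ∨ sliceMul S ℓ = {44, 44, 22} ∨
       sliceMul S ℓ = {45, 42, 23} ∨ sliceMul S ℓ = {44, 43, 23} ∨
       sliceMul S ℓ = {43, 43, 24}) := by
  obtain ⟨m, hm, i, j, k, hij, hik, hjk, h⟩ := exists_levels_of_card hS hcard
  refine ⟨m, hm, ?_⟩
  rw [sliceMul_eq S m hij hik hjk]
  simp only [List.mem_cons, List.not_mem_nil, or_false, Prod.mk.injEq] at h
  rcases h with ⟨h₁, h₂, h₃⟩ | ⟨h₁, h₂, h₃⟩ | ⟨h₁, h₂, h₃⟩ | ⟨h₁, h₂, h₃⟩ | ⟨h₁, h₂, h₃⟩ |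
    ⟨h₁, h₂, h₃⟩ | ⟨h₁, h₂, h₃⟩ <;> simp only [h₁, h₂, h₃, true_or, or_true]
end
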